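/- arXiv:2009.05606 — 2 statements merged into one kernel-verified Lean document; each statement's English description precedes it below -/
import Mathlib

section
/- Let μ be a T-invariant, ergodic probability measure on M with periodic repetitive pattern. Then μ has atomic disintegration along the vertical fibers: for ν-almost every ξ ∈ Σ_k (where ν = π_*μ) the conditional measure μ_ξ is purely atomic. -/
open MeasureTheory Filter Set
open scoped ENNReal NNReal

noncomputable section

/-- The two-sided full shift space on `k` symbols. -/
abbrev Shift (k : ℕ) := ℤ → Fin k

/-- The shift map `σ`. -/
def shiftMap (k : ℕ) : Shift k → Shift k := fun ξ i => ξ (i + 1)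

/-- The circle `S¹`, modelled as `ℝ/ℤ`. -/
abbrev Circle1 := AddCircle (1 : ℝ)

/-- The phase space `M = Σ_k × S¹`. -/
abbrev SkewM (k : ℕ) := Shift k × Circle1

/-- Canonical projection `ℝ → S¹`. -/
def projCircle : ℝ → Circle1 := fun x => (x : Circle1)

/-- A locally constant skew product system over the full shift with circle fibers:
the fiber maps `f j` are `C¹` diffeomorphisms of the circle, recorded together with
lifts `F j : ℝ → ℝ`. -/
structure SkewSetup (k : ℕ) where
  f : Fin k → Circle1 → Circle1
  F : Fin k → ℝ → ℝ
  compat : ∀ j (x : ℝ), f j (projCircle x) = projCircle (F j x)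
  F_equiv : ∀ j x, F j (x + 1) = F j x + 1
  F_smooth : ∀ j, ContDiff ℝ 1 (F j)
  F_bij : ∀ j, Function.Bijective (F j)
  Finv_smooth : ∀ j, ContDiff ℝ 1 (Function.invFun (F j))

/-- The skew product map `T(ξ,x) = (σξ, f_{ξ₀} x)`. -/
def SkewSetup.T {k : ℕ} (S : SkewSetup k) : SkewM k → SkewM k :=
  fun z => (shiftMap k z.1, S.f (z.1 0) z.2)

/-- The composition `f_{w (m-1)} ∘ ⋯ ∘ f_{w 0}` of the fiber maps along a word `w`. -/
def SkewSetup.wordComp {k : ℕ} (S : SkewSetup k) (w : ℕ → Fin k) : ℕ → Circle1 → Circle1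
  | 0 => id
  | m + 1 => S.f (w m) ∘ S.wordComp w m

/-- The corresponding composition of the lifts. -/
def SkewSetup.wordCompLift {k : ℕ} (S : SkewSetup k) (w : ℕ → Fin k) : ℕ → ℝ → ℝ
  | 0 => id
  | m + 1 => S.F (w m) ∘ S.wordCompLift w m

/-- A sequence of `T`-periodic orbits with repetitive pattern (Definition 2.2 of the paper).
The `n`-th periodic point is `(ξ n, q n)` where `ξ n` is the infinite repetition of the
word `w n 0, …, w n (π n - 1)`; the intervals `J n ⊆ S¹` are the arcs
`projCircle '' Icc (a n) (b n)`. -/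
structure RepetitivePattern {k : ℕ} (S : SkewSetup k) where
  /-- the periods -/
  π : ℕ → ℕ
  π_pos : ∀ n, 0 < π n
  /-- the words (`w n i` is the letter `ω^n_{i+1}` of the paper) -/
  w : ℕ → ℕ → Fin k
  /-- the fiber coordinates of the periodic points -/
  q : ℕ → Circle1
  /-- endpoints of (lifts of) the intervals `J n` -/
  a : ℕ → ℝ
  b : ℕ → ℝ
  a_lt_b : ∀ n, a n < b n
  nested : ∀ n, Icc (a (n + 1)) (b (n + 1)) ⊆ Icc (a n) (b n)
  len_lt : ∀ n, b (n + 1) - a (n + 1) < b n - a n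
  len_to_zero : Tendsto (fun n => b n - a n) atTop (nhds 0)
  q_mem : ∀ n, q n ∈ projCircle '' Icc (a n) (b n)
  /-- `J 0, f_{ω^0_1}(J 0), …, f_{ω^0_{π 0 - 1}}∘⋯∘f_{ω^0_1}(J 0)` are pairwise disjoint -/
  disjoint0 : ∀ ℓ₁ ℓ₂, ℓ₁ < ℓ₂ → ℓ₂ < π 0 →
    Disjoint (S.wordComp (w 0) ℓ₁ '' (projCircle '' Icc (a 0) (b 0)))
             (S.wordComp (w 0) ℓ₂ '' (projCircle '' Icc (a 0) (b 0)))
  /-- `q n` is fixed by `g n = f_{ω^n_{π n}} ∘ ⋯ ∘ f_{ω^n_1}` -/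
  fixed : ∀ n, S.wordComp (w n) (π n) (q n) = q n
  /-- `|g_n'| < 1` on `J n` -/
  contracting : ∀ n, ∀ x ∈ Icc (a n) (b n), |deriv (S.wordCompLift (w n) (π n)) x| < 1
  /-- the numbers `k_n` (for `n ≥ 1`) -/
  kseq : ℕ → ℕ
  /-- the numbers `R_n` (for `n ≥ 1`) -/
  Rseq : ℕ → ℕ
  kseq_ge : ∀ n, 2 ≤ kseq (n + 1)
  Rseq_ge : ∀ n, 1 ≤ Rseq (n + 1)
  /-- `g (n+1) = T_{R (n+1)} ∘ (g n)^{k (n+1)}`, encoded on the level of words: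
  the word of `ξ (n+1)` is `k (n+1)` repetitions of the word of `ξ n` followed by a
  word of length `R (n+1)` -/
  period_eq : ∀ n, π (n + 1) = kseq (n + 1) * π n + Rseq (n + 1)
  word_eq : ∀ n, ∀ i < kseq (n + 1) * π n, w (n + 1) i = w n (i % π n)
  /-- the sequence `λ_n = R_n / (k_n π_{n-1})` is summable -/
  lam_summable : Summable fun n => (Rseq (n + 1) : ℝ) / (kseq (n + 1) * π n)

namespace RepetitivePattern

variable {k : ℕ} {S : SkewSetup k}

/-- The `σ`-periodic point `ξ n`, the infinite repetition of the `n`-th word. -/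
def ξp (P : RepetitivePattern S) (n : ℕ) : Shift k :=
  fun i => P.w n (Int.toNat (i % (P.π n : ℤ)))

/-- The measure `μ_{X_n}`, uniformly distributed on the `n`-th periodic orbit. -/
def μX (P : RepetitivePattern S) (n : ℕ) : Measure (SkewM k) :=
  (P.π n : ℝ≥0∞)⁻¹ • ∑ ℓ ∈ Finset.range (P.π n), Measure.dirac (S.T^[ℓ] (P.ξp n, P.q n))

/-- The projected measure `ν_n`, uniformly distributed on the `σ`-orbit of `ξ n`. -/
def νX (P : RepetitivePattern S) (n : ℕ) : Measure (Shift k) :=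
  (P.π n : ℝ≥0∞)⁻¹ • ∑ ℓ ∈ Finset.range (P.π n), Measure.dirac ((shiftMap k)^[ℓ] (P.ξp n))

end RepetitivePattern

/-- Weak-star convergence of a sequence of measures. -/
def WeakStarTendsto {X : Type*} [TopologicalSpace X] [MeasurableSpace X]
    (μs : ℕ → Measure X) (μ : Measure X) : Prop :=
  ∀ g : C(X, ℝ), Tendsto (fun n => ∫ x, g x ∂(μs n)) atTop (nhds (∫ x, g x ∂μ))

/-- A probability measure on `M` has periodic repetitive pattern if it is the weak-star
limit of the measures `μ_{X_n}` for some sequence of periodic orbits with repetitive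
pattern. -/
def HasPeriodicRepetitivePattern {k : ℕ} (S : SkewSetup k) (μ : Measure (SkewM k)) : Prop :=
  ∃ P : RepetitivePattern S, WeakStarTendsto (fun n => P.μX n) μ

/-- The Kolmogorov–Sinai (measure-theoretic) entropy of `T` with respect to `μ`:
the supremum, over all finite measurable colorings `c : X → Fin m`, of the entropy of the
associated process, the latter being computed (via subadditivity) as the infimum of
`H_n/n` where `H_n` is the Shannon entropy of the partition of `X` according to the
itinerary `(c x, c (T x), …, c (T^{n-1} x))`. -/
def ksEntropy {X : Type*} [MeasurableSpace X] (T : X → X) (μ : Measure X) : ℝ≥0∞ :=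
  ⨆ (m : ℕ) (c : {c : X → Fin m // Measurable c}),
    ⨅ n : ℕ, ENNReal.ofReal
      ((∑ s : Fin (n + 1) → Fin m,
        Real.negMulLog ((μ {x | ∀ i : Fin (n + 1), c.1 (T^[(i : ℕ)] x) = s i}).toReal))
        / ((n : ℝ) + 1))


/-- A family `md ξ` of measures is a (Rokhlin) disintegration of `μ` along the vertical
fibers `{ξ} × S¹`, with respect to the projection `ν` of `μ` to the base: almost every
`md ξ` is a probability measure concentrated on the fiber over `ξ`, and `μ` is the
integral of the family against `ν`. -/
def IsDisintegration {k : ℕ} (μ : Measure (SkewM k)) (ν : Measure (Shift k))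
    (md : Shift k → Measure (SkewM k)) : Prop :=
  (∀ᵐ ξ ∂ν, IsProbabilityMeasure (md ξ)) ∧
  (∀ᵐ ξ ∂ν, md ξ ({ξ} ×ˢ (Set.univ : Set Circle1)) = 1) ∧
  (∀ A : Set (SkewM k), MeasurableSet A → μ A = ∫⁻ ξ, md ξ A ∂ν)

/-- A measure is (purely) atomic if it is carried by a countable set. -/
def IsAtomicMeasure {X : Type*} [MeasurableSpace X] (m : Measure X) : Prop :=
  ∃ s : Set X, s.Countable ∧ m sᶜ = 0


namespace SkewSetup

variable {k : ℕ} (S : SkewSetup k)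

theorem wordComp_congr {w w' : ℕ → Fin k} {m : ℕ} (h : ∀ i < m, w i = w' i) :
    S.wordComp w m = S.wordComp w' m := by
  induction m with
  | zero => rfl
  | succ m ih => simp only [wordComp, h m (by omega), ih fun i hi => h i (by omega)]

theorem wordCompLift_congr {w w' : ℕ → Fin k} {m : ℕ} (h : ∀ i < m, w i = w' i) :
    S.wordCompLift w m = S.wordCompLift w' m := by
  induction m with
  | zero => rfl
  | succ m ih => simp only [wordCompLift, h m (by omega), ih fun i hi => h i (by omega)]

theorem wordCompLift_add (w : ℕ → Fin k) (p q : ℕ) :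
    S.wordCompLift w (p + q) = S.wordCompLift (fun i => w (p + i)) q ∘ S.wordCompLift w p := by
  induction q with
  | zero => rfl
  | succ q ih =>
    change S.F (w (p + q)) ∘ S.wordCompLift w (p + q) = _
    rw [ih]
    rfl

theorem wordComp_proj (w : ℕ → Fin k) (m : ℕ) (x : ℝ) :
    S.wordComp w m (projCircle x) = projCircle (S.wordCompLift w m x) := by
  induction m with
  | zero => rfl
  | succ m ih => simp only [wordComp, wordCompLift, Function.comp_apply, ih, S.compat]

theorem lift_strictMono (j : Fin k) : StrictMono (S.F j) := by
  refine ((S.F_smooth j).continuous.strictMono_of_inj (S.F_bij j).injective).resolve_right ?_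
  intro h
  have h1 := h (show (0 : ℝ) < 0 + 1 by norm_num)
  rw [S.F_equiv] at h1
  linarith

theorem wordCompLift_strictMono (w : ℕ → Fin k) (m : ℕ) : StrictMono (S.wordCompLift w m) := by
  induction m with
  | zero => exact strictMono_id
  | succ m ih => exact (S.lift_strictMono _).comp ih

theorem wordCompLift_contDiff (w : ℕ → Fin k) (m : ℕ) : ContDiff ℝ 1 (S.wordCompLift w m) := by
  induction m with
  | zero => exact contDiff_id
  | succ m ih => exact (S.F_smooth _).comp ih

theorem wordCompLift_add_one (w : ℕ → Fin k) (m : ℕ) (x : ℝ) :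
    S.wordCompLift w m (x + 1) = S.wordCompLift w m x + 1 := by
  induction m with
  | zero => rfl
  | succ m ih => simp only [wordCompLift, Function.comp_apply, ih, S.F_equiv]

theorem wordCompLift_add_int (w : ℕ → Fin k) (m : ℕ) (x : ℝ) (l : ℤ) :
    S.wordCompLift w m (x + l) = S.wordCompLift w m x + l := by
  have nat (n : ℕ) (x : ℝ) : S.wordCompLift w m (x + n) = S.wordCompLift w m x + n := by
    induction n with
    | zero => simp
    | succ n ih => rw [Nat.cast_succ, ← add_assoc, wordCompLift_add_one, ih, add_assoc]
  obtain ⟨n, rfl | rfl⟩ := l.eq_nat_or_neg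
  · exact_mod_cast nat n x
  · have := nat n (x + ((-n : ℤ) : ℝ))
    push_cast at this ⊢
    rw [neg_add_cancel_right] at this
    linarith

theorem wordCompLift_sub_int (w : ℕ → Fin k) (m : ℕ) (x : ℝ) (l : ℤ) :
    S.wordCompLift w m (x - l) = S.wordCompLift w m x - l := by
  simpa [sub_eq_add_neg] using S.wordCompLift_add_int w m x (-l)

theorem projCircle_add_int (x : ℝ) (l : ℤ) : projCircle (x + l) = projCircle x := by
  simp [projCircle]

theorem projCircle_sub_int (x : ℝ) (l : ℤ) : projCircle (x - l) = projCircle x := by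
  have := projCircle_add_int (x - l) l
  rwa [sub_add_cancel, eq_comm] at this

theorem projCircle_eq_iff {x y : ℝ} : projCircle x = projCircle y ↔ ∃ l : ℤ, x = y + l := by
  rw [projCircle, projCircle, eq_comm, QuotientAddGroup.eq, AddSubgroup.mem_zmultiples_iff]
  constructor
  · rintro ⟨l, hl⟩
    refine ⟨l, ?_⟩
    simp at hl
    linarith
  · rintro ⟨l, hl⟩
    exact ⟨l, by simp [hl]⟩

theorem f_continuous (j : Fin k) : Continuous (S.f j) := by
  have h : Continuous fun x : ℝ => S.f j (x : Circle1) := by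
    have : (fun x : ℝ => S.f j (x : Circle1)) = fun x : ℝ => ((S.F j x : ℝ) : Circle1) :=
      funext fun x => S.compat j x
    rw [this]
    exact (AddCircle.continuous_mk' 1).comp (S.F_smooth j).continuous
  exact QuotientAddGroup.isOpenQuotientMap_mk.isQuotientMap.continuous_iff.2 h

theorem f_injective (j : Fin k) : Function.Injective (S.f j) := by
  intro x y
  induction x using QuotientAddGroup.induction_on with
  | H x =>
    induction y using QuotientAddGroup.induction_on with
    | H y =>
      intro h
      change S.f j (projCircle x) = S.f j (projCircle y) at h
      change projCircle x = projCircle y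
      rw [S.compat, S.compat, projCircle_eq_iff] at h
      obtain ⟨l, hl⟩ := h
      rw [projCircle_eq_iff]
      refine ⟨l, (S.F_bij j).injective ?_⟩
      have := S.wordCompLift_add_int (fun _ => j) 1 y l
      simp only [wordCompLift, Function.comp_apply, id] at this
      rw [hl, this]

theorem wordComp_continuous (w : ℕ → Fin k) (m : ℕ) : Continuous (S.wordComp w m) := by
  induction m with
  | zero => exact continuous_id
  | succ m ih => exact (S.f_continuous _).comp ih

theorem shift_iterate_apply (s : ℕ) (ξ : Shift k) (i : ℤ) : (shiftMap k)^[s] ξ i = ξ (i + s) := by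
  induction s generalizing i with
  | zero => simp
  | succ s ih =>
    rw [Function.iterate_succ_apply', shiftMap, ih]
    congr 1
    push_cast
    ring

theorem T_iterate (s : ℕ) (z : SkewM k) :
    S.T^[s] z = ((shiftMap k)^[s] z.1, S.wordComp (fun i => z.1 i) s z.2) := by
  induction s with
  | zero => rfl
  | succ s ih =>
    rw [Function.iterate_succ_apply', ih]
    simp only [SkewSetup.T, shift_iterate_apply, Function.iterate_succ_apply', wordComp,
      Function.comp_apply, zero_add]

theorem continuous_shift : Continuous (shiftMap k) :=
  continuous_pi fun i => continuous_apply (i + 1)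

theorem continuous_T : Continuous S.T := by
  refine (continuous_shift.comp continuous_fst).prodMk ?_
  have h : Continuous fun p : Fin k × Circle1 => S.f p.1 p.2 :=
    continuous_prod_of_discrete_left.2 S.f_continuous
  have h2 : Continuous fun z : SkewM k => (z.1 0, z.2) :=
    ((continuous_apply 0).comp continuous_fst).prodMk continuous_snd
  exact h.comp h2

theorem T_injective : Function.Injective S.T := by
  rintro ⟨ξ, x⟩ ⟨η, y⟩ h
  simp only [SkewSetup.T, Prod.mk.injEq] at h
  have h1 : ξ = η := by
    funext i
    simpa [shiftMap] using congrFun h.1 (i - 1)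
  subst h1
  rw [S.f_injective _ h.2]

end SkewSetup

namespace RepetitivePattern

variable {k : ℕ} {S : SkewSetup k} (P : RepetitivePattern S)

/-- The infinite repetition of the `n`-th word. -/
def cyc (n i : ℕ) : Fin k := P.w n (i % P.π n)

/-- The positions at which the construction places a copy of the `n`-th word in the
`m`-th word. -/
def starts (n : ℕ) : ℕ → Finset ℕ
  | 0 => {0}
  | m + 1 => if n ≤ m then
      (Finset.range (P.kseq (m + 1)) ×ˢ starts n m).image fun p => p.1 * P.π m + p.2
    else {0}

theorem starts_self (n : ℕ) : P.starts n n = {0} := by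
  cases n with
  | zero => rfl
  | succ n => simp [starts]

theorem starts_succ {n m : ℕ} (h : n ≤ m) : P.starts n (m + 1) =
    (Finset.range (P.kseq (m + 1)) ×ˢ P.starts n m).image fun p => p.1 * P.π m + p.2 := by
  simp [starts, h]

theorem kseq_mul_le (m : ℕ) : P.kseq (m + 1) * P.π m ≤ P.π (m + 1) := by
  rw [P.period_eq]; omega

theorem mul_add_period_le {m j p : ℕ} (hj : j < P.kseq (m + 1)) (hp : p ≤ P.π m) :
    j * P.π m + p ≤ P.kseq (m + 1) * P.π m := by
  calc j * P.π m + p ≤ (j + 1) * P.π m := by rw [add_mul, one_mul]; omega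
    _ ≤ _ := Nat.mul_le_mul_right _ hj

theorem add_period_le_of_mem_starts {n m s : ℕ} (h : n ≤ m) (hs : s ∈ P.starts n m) :
    s + P.π n ≤ P.π m := by
  induction m, h using Nat.le_induction generalizing s with
  | base => simp_all [starts_self]
  | succ m h ih =>
    rw [P.starts_succ h, Finset.mem_image] at hs
    obtain ⟨⟨j, t⟩, hjt, rfl⟩ := hs
    rw [Finset.mem_product, Finset.mem_range] at hjt
    rw [add_assoc]
    exact (P.mul_add_period_le hjt.1 (ih hjt.2)).trans (P.kseq_mul_le m)

theorem lt_of_mem_starts {n m s : ℕ} (h : n ≤ m) (hs : s ∈ P.starts n m) : s < P.π m := by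
  have := P.add_period_le_of_mem_starts h hs
  have := P.π_pos n
  omega

theorem w_eq_cyc {m i : ℕ} (hi : i < P.kseq (m + 1) * P.π m) : P.w (m + 1) i = P.cyc m i :=
  P.word_eq m i hi

theorem cyc_of_lt {n i : ℕ} (hi : i < P.π n) : P.cyc n i = P.w n i := by
  rw [cyc, Nat.mod_eq_of_lt hi]

theorem cyc_mul_add (n j i : ℕ) : P.cyc n (j * P.π n + i) = P.cyc n i := by
  rw [cyc, cyc, add_comm, Nat.add_mul_mod_self_right]

theorem cyc_periodic (n : ℕ) : Function.Periodic (P.cyc n) (P.π n) := fun i => by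
  rw [cyc, cyc, Nat.add_mod_right]

theorem w_add_of_mem_starts {n m s i : ℕ} (h : n ≤ m) (hs : s ∈ P.starts n m) (hi : i < P.π n) :
    P.w m (s + i) = P.w n i := by
  induction m, h using Nat.le_induction generalizing s with
  | base => simp_all [starts_self]
  | succ m h ih =>
    rw [P.starts_succ h, Finset.mem_image] at hs
    obtain ⟨⟨j, t⟩, hjt, rfl⟩ := hs
    rw [Finset.mem_product, Finset.mem_range] at hjt
    have ht : t + i < P.π m := by
      have := P.add_period_le_of_mem_starts h hjt.2
      omega
    have h1 := P.mul_add_period_le hjt.1 (show t + i + 1 ≤ P.π m from ht)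
    rw [add_assoc, P.w_eq_cyc (by omega), P.cyc_mul_add, P.cyc_of_lt ht, ih hjt.2]

section Sums

variable {M : Type*} [AddCommMonoid M]

theorem sum_starts_succ {n m : ℕ} (h : n ≤ m) (φ : ℕ → M) :
    ∑ s ∈ P.starts n (m + 1), φ s =
      ∑ j ∈ Finset.range (P.kseq (m + 1)), ∑ s ∈ P.starts n m, φ (j * P.π m + s) := by
  rw [P.starts_succ h, Finset.sum_image, Finset.sum_product]
  rintro ⟨j, s⟩ hs ⟨j', s'⟩ hs' heq
  simp only [Finset.coe_product, Set.mem_prod, Finset.mem_coe] at hs hs' heq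
  have h1 := P.lt_of_mem_starts h hs.2
  have h2 := P.lt_of_mem_starts h hs'.2
  have h3 : (s + j * P.π m) % P.π m = (s' + j' * P.π m) % P.π m := by
    rw [add_comm s, add_comm s', heq]
  rw [Nat.add_mul_mod_self_right, Nat.add_mul_mod_self_right, Nat.mod_eq_of_lt h1,
    Nat.mod_eq_of_lt h2] at h3
  subst h3
  rw [Nat.add_right_cancel_iff] at heq
  rw [Nat.eq_of_mul_eq_mul_right (P.π_pos m) heq]

theorem sum_starts {n m l : ℕ} (h : n ≤ m) (h' : m ≤ l) (φ : ℕ → M) :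
    ∑ s ∈ P.starts n l, φ s = ∑ s ∈ P.starts m l, ∑ t ∈ P.starts n m, φ (s + t) := by
  induction l, h' using Nat.le_induction generalizing φ with
  | base => simp [starts_self]
  | succ l h' ih =>
    rw [P.sum_starts_succ (h.trans h'), P.sum_starts_succ h']
    refine Finset.sum_congr rfl fun j _ => ?_
    rw [ih]
    simp only [add_assoc]

theorem sum_starts_self_succ (n : ℕ) (φ : ℕ → M) :
    ∑ s ∈ P.starts n (n + 1), φ s = ∑ j ∈ Finset.range (P.kseq (n + 1)), φ (j * P.π n) := by
  simp [P.sum_starts_succ le_rfl, starts_self]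

end Sums

theorem _root_.Finset.sum_range_mul_eq {M : Type*} [AddCommMonoid M] (φ : ℕ → M) (a b : ℕ) :
    ∑ p ∈ Finset.range (a * b), φ p =
      ∑ j ∈ Finset.range a, ∑ i ∈ Finset.range b, φ (j * b + i) := by
  induction a with
  | zero => simp
  | succ a ih => rw [add_mul, one_mul, Finset.sum_range_add, ih, Finset.sum_range_succ]

theorem sum_starts_le {n m : ℕ} (h : n ≤ m) (φ : ℕ → ℝ≥0∞) :
    ∑ s ∈ P.starts n m, ∑ i ∈ Finset.range (P.π n), φ (s + i) ≤
      ∑ p ∈ Finset.range (P.π m), φ p := by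
  induction m, h using Nat.le_induction generalizing φ with
  | base => simp [starts_self]
  | succ m h ih =>
    rw [P.sum_starts_succ h]
    calc _ ≤ ∑ j ∈ Finset.range (P.kseq (m + 1)), ∑ p ∈ Finset.range (P.π m), φ (j * P.π m + p) :=
          Finset.sum_le_sum fun j _ => by
            simpa only [add_assoc] using ih fun p => φ (j * P.π m + p)
      _ = ∑ p ∈ Finset.range (P.kseq (m + 1) * P.π m), φ p := (Finset.sum_range_mul_eq _ _ _).symm
      _ ≤ _ := Finset.sum_le_sum_of_subset (Finset.range_mono (P.kseq_mul_le m))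

theorem card_starts_succ {n m : ℕ} (h : n ≤ m) :
    (P.starts n (m + 1)).card = P.kseq (m + 1) * (P.starts n m).card := by
  simp only [Finset.card_eq_sum_ones, P.sum_starts_succ h]
  simp

theorem card_starts_mul {n m l : ℕ} (h : n ≤ m) (h' : m ≤ l) :
    (P.starts n l).card = (P.starts m l).card * (P.starts n m).card := by
  simp only [Finset.card_eq_sum_ones, P.sum_starts h h']
  simp

theorem card_starts_mul_le {n m : ℕ} (h : n ≤ m) : (P.starts n m).card * P.π n ≤ P.π m := by
  have := P.sum_starts_le h fun _ => 1
  simp only [Finset.sum_const, Finset.card_range, nsmul_eq_mul, mul_one] at this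
  exact_mod_cast this

theorem card_starts_pos {n m : ℕ} (h : n ≤ m) : 0 < (P.starts n m).card := by
  induction m, h using Nat.le_induction with
  | base => simp [starts_self]
  | succ m h ih =>
    rw [P.card_starts_succ h]
    have := P.kseq_ge m
    positivity

theorem exists_density : ∃ ρ : ℝ, 0 < ρ ∧ ∀ n m, n ≤ m →
    ρ * P.π m ≤ (P.starts n m).card * P.π n := by
  set lam : ℕ → ℝ := fun n => (P.Rseq (n + 1) : ℝ) / (P.kseq (n + 1) * P.π n) with hlam
  have hlam0 : ∀ n, 0 ≤ lam n := fun n => by positivity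
  have key : ∀ n m, n ≤ m →
      (P.π m : ℝ) ≤ (P.starts n m).card * P.π n * Real.exp (∑ i ∈ Finset.range m, lam i) := by
    intro n m h
    induction m, h using Nat.le_induction with
    | base =>
      have : 0 ≤ ∑ i ∈ Finset.range n, lam i := Finset.sum_nonneg fun i _ => hlam0 i
      simpa [starts_self] using le_mul_of_one_le_right (Nat.cast_nonneg _) (Real.one_le_exp this)
    | succ m h ih =>
      have hk : (0 : ℝ) < P.kseq (m + 1) * P.π m := by
        have := P.kseq_ge m
        have := P.π_pos m
        positivity
      have h1 : (P.π (m + 1) : ℝ) = P.kseq (m + 1) * P.π m * (lam m + 1) := by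
        rw [P.period_eq, hlam, mul_add, mul_one, mul_div_cancel₀ _ hk.ne']
        push_cast
        ring
      rw [h1, P.card_starts_succ h, Finset.sum_range_succ, Real.exp_add]
      push_cast
      calc (P.kseq (m + 1) * P.π m * (lam m + 1) : ℝ)
          ≤ P.kseq (m + 1) * ((P.starts n m).card * P.π n *
              Real.exp (∑ i ∈ Finset.range m, lam i)) * Real.exp (lam m) := by
            refine mul_le_mul ?_ (Real.add_one_le_exp _) (by linarith [hlam0 m]) (by positivity)
            gcongr
        _ = _ := by ring
  refine ⟨Real.exp (-∑' i, lam i), Real.exp_pos _, fun n m h => ?_⟩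
  have h1 : Real.exp (∑ i ∈ Finset.range m, lam i) ≤ Real.exp (∑' i, lam i) :=
    Real.exp_le_exp.2 (P.lam_summable.sum_le_tsum _ fun i _ => hlam0 i)
  calc Real.exp (-∑' i, lam i) * P.π m
      ≤ Real.exp (-∑' i, lam i) *
          ((P.starts n m).card * P.π n * Real.exp (∑' i, lam i)) := by
        gcongr
        exact (key n m h).trans (by gcongr)
    _ = (P.starts n m).card * P.π n * (Real.exp (-∑' i, lam i) * Real.exp (∑' i, lam i)) := by ring
    _ = _ := by rw [← Real.exp_add]; simp

/-- The starting positions at which the copy of the `n`-th word is followed by another copy. -/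
def dblStarts (n m : ℕ) : Finset ℕ :=
  (P.starts n m).filter fun t =>
    t + 2 * P.π n ≤ P.π m ∧ ∀ i < 2 * P.π n, P.w m (t + i) = P.cyc n i

theorem dblStarts_subset (n m : ℕ) : P.dblStarts n m ⊆ P.starts n m := Finset.filter_subset _ _

theorem card_starts_le_two_mul {n m : ℕ} (h : n + 1 ≤ m) :
    (P.starts n m).card ≤ 2 * (P.dblStarts n m).card := by
  have hn : n ≤ n + 1 := n.le_succ
  rw [dblStarts, Finset.card_filter, P.sum_starts hn h, P.card_starts_mul hn h,
    Finset.card_eq_sum_ones (P.starts (n + 1) m), Finset.sum_mul, Finset.mul_sum]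
  refine Finset.sum_le_sum fun s hs => ?_
  rw [P.sum_starts_self_succ, P.card_starts_succ le_rfl, P.starts_self, Finset.card_singleton]
  have hk := P.kseq_ge n
  obtain ⟨K, hK⟩ : ∃ K, P.kseq (n + 1) = K + 1 := ⟨P.kseq (n + 1) - 1, by omega⟩
  have hR := P.add_period_le_of_mem_starts h hs
  have hle := P.kseq_mul_le n
  rw [hK, Finset.sum_range_succ, Finset.sum_congr rfl (g := fun _ => 1)]
  · simp only [Finset.sum_const, Finset.card_range]
    simp only [smul_eq_mul, mul_one, one_mul]
    omega
  · intro j hj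
    rw [Finset.mem_range] at hj
    have h2 : j * P.π n + 2 * P.π n ≤ P.kseq (n + 1) * P.π n := by
      rw [← add_mul, hK]
      exact Nat.mul_le_mul_right _ (by omega)
    refine if_pos ⟨by omega, fun i hi => ?_⟩
    rw [add_assoc, P.w_add_of_mem_starts h hs (by omega), P.w_eq_cyc (by omega), P.cyc_mul_add]

theorem wordCompLift_w_eq {m p : ℕ} (hp : p ≤ P.kseq (m + 1) * P.π m) :
    S.wordCompLift (P.w (m + 1)) p = S.wordCompLift (P.cyc m) p :=
  S.wordCompLift_congr fun _ hi => P.w_eq_cyc (by omega)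

theorem exists_fixed_lift (n : ℕ) : ∃ c ∈ Icc (P.a n) (P.b n), P.q n = projCircle c ∧
    ∃ l : ℤ, S.wordCompLift (P.cyc n) (P.π n) c = c + l := by
  obtain ⟨c, hc, hq⟩ := P.q_mem n
  refine ⟨c, hc, hq.symm, ?_⟩
  have h := P.fixed n
  rw [← hq, S.wordComp_proj, SkewSetup.projCircle_eq_iff] at h
  rwa [S.wordCompLift_congr (w' := P.w n) fun i hi => P.cyc_of_lt hi]

theorem exists_int_mapsTo_period (n : ℕ) : ∃ l : ℤ, ∀ x ∈ Icc (P.a n) (P.b n),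
    S.wordCompLift (P.cyc n) (P.π n) x - l ∈ Icc (P.a n) (P.b n) := by
  obtain ⟨c, hc, -, l, hl⟩ := P.exists_fixed_lift n
  refine ⟨l, fun x hx => ?_⟩
  rw [S.wordCompLift_congr (w' := P.w n) fun i hi => P.cyc_of_lt hi] at hl ⊢
  have hmono := (S.wordCompLift_strictMono (P.w n) (P.π n)).monotone
  have hlip := (convex_Icc (P.a n) (P.b n)).norm_image_sub_le_of_norm_deriv_le (C := 1)
    (fun y _ => ((S.wordCompLift_contDiff (P.w n) (P.π n)).differentiable one_ne_zero) y)
    (fun y hy => (P.contracting n y hy).le) hc hx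
  rw [one_mul, Real.norm_eq_abs, Real.norm_eq_abs, hl] at hlip
  rw [mem_Icc] at hc hx ⊢
  rcases le_total c x with h | h
  · have := hmono h
    rw [abs_of_nonneg (by linarith), abs_of_nonneg (by linarith)] at hlip
    constructor <;> linarith
  · have := hmono h
    rw [abs_of_nonpos (by linarith), abs_of_nonpos (by linarith)] at hlip
    constructor <;> linarith

theorem wordCompLift_cyc_mul_add (n j s : ℕ) : S.wordCompLift (P.cyc n) (j * P.π n + s) =
    S.wordCompLift (P.cyc n) s ∘ S.wordCompLift (P.cyc n) (j * P.π n) := by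
  rw [S.wordCompLift_add]
  simp only [P.cyc_mul_add]

theorem exists_int_mapsTo_mul (n j : ℕ) : ∃ l : ℤ, ∀ x ∈ Icc (P.a n) (P.b n),
    S.wordCompLift (P.cyc n) (j * P.π n) x - l ∈ Icc (P.a n) (P.b n) := by
  induction j with
  | zero => exact ⟨0, fun x hx => by simpa [SkewSetup.wordCompLift] using hx⟩
  | succ j ih =>
    obtain ⟨l, hl⟩ := ih
    obtain ⟨l', hl'⟩ := P.exists_int_mapsTo_period n
    refine ⟨l + l', fun x hx => ?_⟩
    have h := hl' _ (hl x hx)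
    rw [S.wordCompLift_sub_int] at h
    rw [add_mul, one_mul, P.wordCompLift_cyc_mul_add, Function.comp_apply]
    push_cast at h ⊢
    convert h using 1
    ring

theorem exists_int_mapsTo {n m s : ℕ} (h : n ≤ m) (hs : s ∈ P.starts n m) :
    ∃ l : ℤ, ∀ x ∈ Icc (P.a m) (P.b m),
      S.wordCompLift (P.w m) s x - l ∈ Icc (P.a n) (P.b n) := by
  induction m, h using Nat.le_induction generalizing s with
  | base =>
    rw [starts_self, Finset.mem_singleton] at hs
    subst hs
    exact ⟨0, fun x hx => by simpa [SkewSetup.wordCompLift] using hx⟩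
  | succ m h ih =>
    rw [P.starts_succ h, Finset.mem_image] at hs
    obtain ⟨⟨j, t⟩, hjt, rfl⟩ := hs
    rw [Finset.mem_product, Finset.mem_range] at hjt
    obtain ⟨l, hl⟩ := ih hjt.2
    obtain ⟨l', hl'⟩ := P.exists_int_mapsTo_mul m j
    have ht := P.lt_of_mem_starts h hjt.2
    refine ⟨l' + l, fun x hx => ?_⟩
    have h1 := hl _ (hl' x (P.nested m hx))
    rw [S.wordCompLift_sub_int] at h1
    rw [P.wordCompLift_w_eq (P.mul_add_period_le hjt.1 ht.le), P.wordCompLift_cyc_mul_add,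
      Function.comp_apply, S.wordCompLift_congr (w := P.cyc m) (w' := P.w m)
        fun i hi => P.cyc_of_lt (by dsimp only at hi; omega)]
    push_cast at h1 ⊢
    convert h1 using 1
    ring

theorem ξp_natCast (n i : ℕ) : P.ξp n i = P.cyc n i := by
  simp only [ξp, cyc]
  norm_cast

theorem T_iterate_ξp (n s : ℕ) : S.T^[s] (P.ξp n, P.q n) =
    ((shiftMap k)^[s] (P.ξp n), S.wordComp (P.cyc n) s (P.q n)) := by
  rw [S.T_iterate]
  simp only [P.ξp_natCast]

theorem wordComp_cyc_q_mem {n m s : ℕ} (h : n ≤ m) (hs : s ∈ P.starts n m) :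
    S.wordComp (P.cyc m) s (P.q m) ∈ projCircle '' Icc (P.a n) (P.b n) := by
  obtain ⟨l, hl⟩ := P.exists_int_mapsTo h hs
  obtain ⟨c, hc, hq⟩ := P.q_mem m
  have ht := P.lt_of_mem_starts h hs
  refine ⟨_, hl c hc, ?_⟩
  rw [SkewSetup.projCircle_sub_int, ← S.wordComp_proj, hq, S.wordComp_congr]
  exact fun i hi => (P.cyc_of_lt (by omega)).symm

/-- The `n`-th word is not a proper power. -/
def IsPrim (n : ℕ) : Prop := ∀ d, 0 < d → d < P.π n → ¬ Function.Periodic (P.cyc n) d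

theorem exists_period_of_not_isPrim {n : ℕ} (h : ¬ P.IsPrim n) :
    ∃ d, 0 < d ∧ 2 * d ≤ P.π n ∧ Function.Periodic (P.cyc n) d := by
  classical
  simp only [IsPrim, not_forall, not_not] at h
  have hex : ∃ d, 0 < d ∧ d < P.π n ∧ Function.Periodic (P.cyc n) d :=
    let ⟨d, h1, h2, h3⟩ := h; ⟨d, h1, h2, h3⟩
  obtain ⟨h1, h2, h3⟩ := Nat.find_spec hex
  set d := Nat.find hex with hd
  refine ⟨d, h1, ?_, h3⟩
  have hmod : P.π n % d = 0 := by
    by_contra hne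
    refine Nat.find_min hex (m := P.π n % d) (Nat.mod_lt _ h1)
      ⟨Nat.pos_of_ne_zero hne, (Nat.mod_lt _ h1).trans h2, fun i => ?_⟩
    have h4 := h3.nat_mul (P.π n / d) (i + P.π n % d)
    rw [← h4, add_assoc, Nat.cast_id, mul_comm, Nat.mod_add_div, P.cyc_periodic]
  obtain ⟨c, hc⟩ := Nat.dvd_of_mod_eq_zero hmod
  rcases c with _ | _ | c
  · have := P.π_pos n
    omega
  · omega
  · rw [hc, mul_comm]
    exact Nat.mul_le_mul_left _ (by omega)

theorem _root_.Function.Periodic.eq_of_eqOn_lt_add {α : Type*} {u v : ℕ → α} {d e : ℕ}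
    (hd : 0 < d) (he : 0 < e) (hu : Function.Periodic u e) (hv : Function.Periodic v d)
    (h : ∀ i < d + e, u i = v i) : u = v := by
  funext i
  induction i using Nat.strong_induction_on with
  | _ i ih =>
    by_cases hi : i < d + e
    · exact h i hi
    · obtain ⟨j, rfl⟩ := Nat.exists_eq_add_of_le (not_lt.1 hi)
      have h1 : u (j + d + e) = u (j + d) := hu _
      have h2 : v (j + e + d) = v (j + e) := hv _
      rw [show d + e + j = j + d + e by ring, h1, show j + d + e = j + e + d by ring, h2]
      rw [ih (j + d) (by omega), hv, ← ih j (by omega), ← ih (j + e) (by omega), hu]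

theorem frequently_isPrim_or_eventually_cyc_eq :
    (∀ N, ∃ n, N ≤ n ∧ P.IsPrim n) ∨ ∃ n₀, ∀ n, n₀ ≤ n → P.cyc n = P.cyc n₀ := by
  by_cases hprim : ∀ N, ∃ n, N ≤ n ∧ P.IsPrim n
  · exact Or.inl hprim
  right
  push Not at hprim
  obtain ⟨N, hN⟩ := hprim
  obtain ⟨N', hN'⟩ := eventually_atTop.1
    (P.lam_summable.tendsto_atTop_zero.eventually_lt_const (show (0 : ℝ) < 1 / 4 by norm_num))
  refine ⟨max N N', fun n hn => ?_⟩
  induction n, hn using Nat.le_induction with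
  | base => rfl
  | succ n hn ih =>
    rw [← ih]
    obtain ⟨d, hd, hd2, hper⟩ := P.exists_period_of_not_isPrim (hN n (by omega))
    obtain ⟨e, he, he2, hper'⟩ := P.exists_period_of_not_isPrim (hN (n + 1) (by omega))
    have hlt := hN' n (by omega)
    have hk := P.kseq_ge n
    have hpos := P.π_pos n
    rw [div_lt_iff₀ (by positivity)] at hlt
    have hR : 4 * P.Rseq (n + 1) < P.kseq (n + 1) * P.π n := by
      have : (4 * P.Rseq (n + 1) : ℝ) < P.kseq (n + 1) * P.π n := by linarith
      exact_mod_cast this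
    have h2 : 2 * P.π n ≤ P.kseq (n + 1) * P.π n := Nat.mul_le_mul_right _ hk
    have h3 := P.period_eq n
    refine Function.Periodic.eq_of_eqOn_lt_add hd he hper' hper fun i hi => ?_
    rw [P.cyc_of_lt (by omega), P.w_eq_cyc (by omega)]

end RepetitivePattern

section Ergodic

variable {X : Type*} [MeasurableSpace X] {μ : Measure X} [IsProbabilityMeasure μ] {T : X → X}

theorem Ergodic.tendsto_birkhoffAverage_indicatorConstLp (herg : Ergodic T μ) {B : Set X}
    (hB : MeasurableSet B) :
    Tendsto (fun N => birkhoffAverage ℝ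
        (Lp.compMeasurePreserving (E := ℝ) (p := 2) T herg.toMeasurePreserving) _root_.id N
        (indicatorConstLp 2 hB (measure_ne_top μ B) (1 : ℝ)))
      atTop (nhds (μ.real B • indicatorConstLp 2 .univ (measure_ne_top μ univ) (1 : ℝ))) := by
  set U := (Lp.compMeasurePreservingₗᵢ ℝ (E := ℝ) (p := 2) T
    herg.toMeasurePreserving).toContinuousLinearMap with hU
  have hU1 : ‖U‖ ≤ 1 := LinearIsometry.norm_toContinuousLinearMap_le _
  have h := U.tendsto_birkhoffAverage_orthogonalProjection hU1
    (indicatorConstLp 2 hB (measure_ne_top μ B) (1 : ℝ))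
  set fB := indicatorConstLp 2 hB (measure_ne_top μ B) (1 : ℝ) with hfB
  set f1 := indicatorConstLp 2 .univ (measure_ne_top μ univ) (1 : ℝ) with hf1
  set g := (U.eqLocus (1 : Lp ℝ 2 μ →L[ℝ] Lp ℝ 2 μ)).orthogonalProjectionOnto fB with hg
  have hone : U f1 = f1 := Lp.indicatorConstLp_compMeasurePreserving _ _ _ _
  have hgU : U (g : Lp ℝ 2 μ) = g := g.2
  have hcomp : ((g : Lp ℝ 2 μ) : X → ℝ) ∘ T =ᵐ[μ] (g : Lp ℝ 2 μ) := by
    have h1 := Lp.coeFn_compMeasurePreserving (g : Lp ℝ 2 μ) herg.toMeasurePreserving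
    have h2 : Lp.compMeasurePreserving T herg.toMeasurePreserving (g : Lp ℝ 2 μ) = g := hgU
    rw [h2] at h1
    exact h1.symm
  obtain ⟨c, hc⟩ := herg.ae_eq_const_of_ae_eq_comp_ae (Lp.aestronglyMeasurable _) hcomp
  have hgc : (g : Lp ℝ 2 μ) = c • f1 := by
    refine Lp.ext ?_
    filter_upwards [hc, Lp.coeFn_smul c f1, indicatorConstLp_coeFn (p := 2) (hs := .univ)
      (hμs := measure_ne_top μ univ) (c := (1 : ℝ))] with x h1 h2 h3
    rw [h1, h2, Pi.smul_apply, h3]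
    simp
  have hinner : inner ℝ f1 (g : Lp ℝ 2 μ) = inner ℝ f1 fB :=
    Submodule.inner_orthogonalProjectionOnto_eq_of_mem_left
      (K := U.eqLocus (1 : Lp ℝ 2 μ →L[ℝ] Lp ℝ 2 μ)) ⟨f1, hone⟩ fB
  have hcB : c = μ.real B := by
    rw [hgc, inner_smul_right, hf1, hfB, L2.inner_indicatorConstLp_one,
      L2.inner_indicatorConstLp_one, setIntegral_indicatorConstLp .univ,
      setIntegral_indicatorConstLp .univ] at hinner
    simpa using hinner
  rw [hgc, hcB] at h
  exact h

theorem Ergodic.exists_pos_forall_real_le (herg : Ergodic T μ) {B : Set X}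
    (hB : MeasurableSet B) {ε : ℝ} (hε : 0 < ε) : ∃ δ > 0, ∀ Λ : Measure X, Λ ≤ μ →
    (∀ B', MeasurableSet B' → Λ.real B' ≤ Λ.real (T ⁻¹' B') + δ) →
    Λ.real B ≤ Λ.real univ * μ.real B + ε := by
  have hlim := (herg.tendsto_birkhoffAverage_indicatorConstLp hB)
  rw [Metric.tendsto_atTop] at hlim
  obtain ⟨N₀, hN₀⟩ := hlim (ε / 2) (by positivity)
  set N := N₀ + 1 with hN
  have hNpos : (0 : ℝ) < N := by positivity
  have hdist := hN₀ N (by omega)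
  rw [dist_eq_norm] at hdist
  refine ⟨ε / (2 * N), by positivity, fun Λ hΛ hinv => ?_⟩
  have : IsFiniteMeasure Λ := isFiniteMeasure_of_le μ hΛ
  have hac : Λ ≪ μ := Measure.absolutelyContinuous_of_le hΛ
  have hbd : ∀ᵐ x ∂μ, ‖(Λ.rnDeriv μ x).toReal‖ ≤ 1 := by
    filter_upwards [Measure.rnDeriv_le_one_of_le hΛ] with x hx
    rw [Real.norm_of_nonneg ENNReal.toReal_nonneg]
    exact ENNReal.toReal_le_of_le_ofReal zero_le_one (by simpa using hx)
  have hmem : MemLp (fun x => (Λ.rnDeriv μ x).toReal) 2 μ :=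
    MemLp.of_bound (Measure.measurable_rnDeriv _ _).ennreal_toReal.aestronglyMeasurable 1 hbd
  set H : Lp ℝ 2 μ := hmem.toLp _ with hH
  have hHnorm : ‖H‖ ≤ 1 := by
    refine (Lp.norm_le_of_ae_bound (C := 1) zero_le_one ?_).trans_eq ?_
    · filter_upwards [hbd, hmem.coeFn_toLp] with x h1 h2
      rwa [h2]
    · simp [measureUnivNNReal]
  have hind (A : Set X) (hA : MeasurableSet A) :
      inner ℝ (indicatorConstLp 2 hA (measure_ne_top μ A) (1 : ℝ)) H = Λ.real A := by
    rw [L2.inner_indicatorConstLp_one, ← Measure.setIntegral_toReal_rnDeriv hac]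
    exact setIntegral_congr_ae hA (by filter_upwards [hmem.coeFn_toLp] with x hx _ using hx)
  have hTn (j : ℕ) : MeasurableSet (T^[j] ⁻¹' B) :=
    (herg.toMeasurePreserving.iterate j).measurable hB
  have hdrift (j : ℕ) : Λ.real B ≤ Λ.real (T^[j] ⁻¹' B) + j * (ε / (2 * N)) := by
    induction j with
    | zero => simp
    | succ j ih =>
      have := hinv _ (hTn j)
      rw [← preimage_comp, ← Function.iterate_succ] at this
      push_cast
      linarith
  have hav : N * Λ.real B ≤ N * inner ℝ (birkhoffAverage ℝ
        (Lp.compMeasurePreserving (E := ℝ) (p := 2) T herg.toMeasurePreserving) _root_.id N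
        (indicatorConstLp 2 hB (measure_ne_top μ B) (1 : ℝ))) H + N * (ε / 2) := by
    rw [birkhoffAverage, birkhoffSum, real_inner_smul_left, mul_inv_cancel_left₀ hNpos.ne',
      sum_inner, ← nsmul_eq_mul, ← Finset.card_range N, ← Finset.sum_const, Finset.card_range,
      ← nsmul_eq_mul, ← Finset.card_range N, ← Finset.sum_const, Finset.card_range,
      ← Finset.sum_add_distrib]
    refine Finset.sum_le_sum fun j hj => ?_
    rw [Lp.compMeasurePreserving_iterate, _root_.id, Lp.indicatorConstLp_compMeasurePreserving,
      hind _ (hTn j)]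
    refine (hdrift j).trans ?_
    gcongr
    have hj' : (j : ℝ) ≤ N := by exact_mod_cast (Finset.mem_range.1 hj).le
    calc (j : ℝ) * (ε / (2 * N)) ≤ N * (ε / (2 * N)) := by gcongr
      _ = ε / 2 := by field_simp
  have hcs := (real_inner_le_norm (birkhoffAverage ℝ
        (Lp.compMeasurePreserving (E := ℝ) (p := 2) T herg.toMeasurePreserving) _root_.id N
        (indicatorConstLp 2 hB (measure_ne_top μ B) (1 : ℝ)) -
        μ.real B • indicatorConstLp 2 .univ (measure_ne_top μ univ) (1 : ℝ)) H)
  rw [inner_sub_left, real_inner_smul_left, hind _ .univ] at hcs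
  have h1 := mul_le_mul hdist.le hHnorm (norm_nonneg _) (by positivity)
  rw [← mul_add] at hav
  have h2 := le_of_mul_le_mul_left hav hNpos
  rw [mul_comm (Λ.real univ)]
  linarith

end Ergodic

section Distribution

theorem MeasureTheory.continuous_measureReal_Iic (m : Measure ℝ) [IsFiniteMeasure m]
    [NullSingletonClass m] : Continuous fun t => m.real (Iic t) := by
  have h_integral (s : Set ℝ) : IntegrableOn (fun _ => (1 : ℝ)) s m := (integrable_const 1).integrableOn
  have h := intervalIntegral.continuous_primitive (μ := m) (f := fun _ => (1 : ℝ))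
    (fun a b => (integrable_const 1).intervalIntegrable) 0
  refine (h.add (continuous_const (y := m.real (Iic 0)))).congr fun t => ?_
  rw [Pi.add_apply, ← intervalIntegral.integral_Iic_sub_Iic (h_integral _) (h_integral _)]
  simp

theorem MeasureTheory.exists_measure_Iic_eq (m : Measure ℝ) [IsFiniteMeasure m]
    [NullSingletonClass m] {b : ℝ} {c : ℝ≥0∞} (hc : c ≠ 0) (hcb : c ≤ m (Iic b)) :
    ∃ t, m (Iic t) = c := by
  have hctop : c ≠ ∞ := ne_top_of_le_ne_top (measure_ne_top _ _) hcb
  have hlow : ∃ t, m.real (Iic t) ≤ c.toReal := by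
    have h1 : Tendsto (fun t => m.real univ - m.real (Ici t)) atBot (nhds 0) := by
      have := (ENNReal.tendsto_toReal (measure_ne_top m univ)).comp (tendsto_measure_Ici_atBot m)
      simpa [measureReal_def] using tendsto_const_nhds (x := m.real univ).sub this
    obtain ⟨t, ht⟩ := (h1.eventually_lt_const (ENNReal.toReal_pos hc hctop)).exists
    refine ⟨t, le_trans (le_of_eq ?_) ht.le⟩
    rw [← measureReal_compl measurableSet_Ici, compl_Ici]
    exact measureReal_congr Iio_ae_eq_Iic.symm
  have hup : c.toReal ≤ m.real (Iic b) := ENNReal.toReal_mono (measure_ne_top _ _) hcb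
  obtain ⟨t, ht⟩ := mem_range_of_exists_le_of_exists_ge (continuous_measureReal_Iic m) hlow ⟨b, hup⟩
  exact ⟨t, (ENNReal.toReal_eq_toReal_iff' (measure_ne_top _ _) hctop).1 ht⟩

variable {Y : Type*} [MeasurableSpace Y] (θ : Measure Y) {r : Y → ℝ}

theorem MeasureTheory.nullSingletonClass_map [NullSingletonClass θ] (hr : Measurable r)
    (hinj : Function.Injective r) : NullSingletonClass (θ.map r) :=
  ⟨fun t => by
    rw [Measure.map_apply hr (measurableSet_singleton t)]
    exact (subsingleton_singleton.preimage hinj).measure_zero θ⟩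

variable [IsFiniteMeasure θ] [NullSingletonClass θ]

theorem MeasureTheory.min_le_measure_distribution_le (hr : Measurable r)
    (hinj : Function.Injective r) (b : ℝ) (c : ℝ≥0∞) :
    min c (θ {y | r y ≤ b}) ≤ θ {y | r y ≤ b ∧ θ {z | r z ≤ r y} ≤ c} := by
  have := nullSingletonClass_map θ hr hinj
  have hm (t : ℝ) : θ.map r (Iic t) = θ {y | r y ≤ t} := Measure.map_apply hr measurableSet_Iic
  rcases eq_or_ne c 0 with rfl | hc
  · simp
  rcases le_total (θ {y | r y ≤ b}) c with h | h
  · refine (min_le_right _ _).trans (measure_mono fun y hy => ⟨hy, le_trans ?_ h⟩)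
    exact measure_mono fun z hz => show r z ≤ _ from le_trans hz hy
  · obtain ⟨t, ht⟩ := exists_measure_Iic_eq (θ.map r) hc (by rwa [hm])
    rw [hm] at ht
    rcases le_total t b with htb | htb
    · rw [min_eq_left h, ← ht]
      refine measure_mono fun y hy => ⟨le_trans hy htb, ?_⟩
      exact measure_mono fun z hz => show r z ≤ _ from le_trans hz hy
    · refine (min_le_right _ _).trans (measure_mono fun y hy => ⟨hy, ?_⟩)
      rw [← ht]
      exact measure_mono fun z hz => show r z ≤ _ from le_trans hz (le_trans hy htb)

theorem MeasureTheory.measure_distribution_le_le (hr : Measurable r)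
    (hinj : Function.Injective r) {c : ℝ≥0∞} (hc : c ≠ ∞) :
    θ {y | θ {z | r z ≤ r y} ≤ c} ≤ c := by
  have := nullSingletonClass_map θ hr hinj
  have hm (t : ℝ) : θ.map r (Iic t) = θ {y | r y ≤ t} := Measure.map_apply hr measurableSet_Iic
  set D : Set ℝ := {t | (θ.map r).real (Iic t) ≤ c.toReal} with hD
  have hclosed : IsClosed D := isClosed_le (continuous_measureReal_Iic _) continuous_const
  have hDc {t : ℝ} : t ∈ D ↔ θ {y | r y ≤ t} ≤ c := by
    rw [← hm]
    exact ENNReal.toReal_le_toReal (measure_ne_top _ _) hc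
  rcases D.eq_empty_or_nonempty with hemp | hne
  · refine le_trans (le_of_eq ?_) zero_le
    rw [← measure_empty (μ := θ)]
    congr 1
    refine eq_empty_of_forall_notMem fun y hy => ?_
    have : r y ∈ D := hDc.2 hy
    simp [hemp] at this
  by_cases hbdd : BddAbove D
  · have hs := hclosed.csSup_mem hne hbdd
    refine (measure_mono fun y hy => ?_).trans (hDc.1 hs)
    exact le_csSup hbdd (hDc.2 hy)
  · refine (measure_mono (subset_univ _)).trans ?_
    have htend := tendsto_measure_Iic_atTop (θ.map r)
    rw [Measure.map_apply hr .univ, preimage_univ] at htend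
    refine le_of_tendsto' htend fun t => ?_
    rw [not_bddAbove_iff] at hbdd
    obtain ⟨d, hd, htd⟩ := hbdd t
    rw [hm]
    exact (measure_mono fun z hz => le_trans hz htd.le).trans (hDc.1 hd)

end Distribution

section Fiber

variable {Y : Type*} [MeasurableSpace Y] (θ : Measure Y) [IsProbabilityMeasure θ]
  [NullSingletonClass θ] {r r' : Y → ℝ}

theorem mul_add_measure_le_of_monotone (hr' : Measurable r')
    (hinj : Function.Injective r') {b b' : ℝ} {g : Y → Y}
    (hmaps : ∀ y, r' y ≤ b' → r (g y) ≤ b)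
    (hmono : ∀ y z, r' y ≤ b' → r' z ≤ b' → r (g z) ≤ r (g y) → r' z ≤ r' y)
    {ε : ℝ≥0∞} (hε : ε ≤ 1) :
    ε * θ {y | r' y ≤ b'} + θ {y | r' y ≤ b'} ≤
      θ {y | (r' y ≤ b' ∧ θ {z | r' z ≤ r' y} ≤ ε) ∧
        r (g y) ≤ b ∧ θ {z | r (g z) ≤ r (g y)} ≤ ε} + θ {y | r (g y) ≤ b} := by
  set J := {y | r' y ≤ b'} with hJ
  set I := {y | r (g y) ≤ b} with hI
  set A := {y | (r' y ≤ b' ∧ θ {z | r' z ≤ r' y} ≤ ε) ∧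
        r (g y) ≤ b ∧ θ {z | r (g z) ≤ r (g y)} ≤ ε} with hA
  have hJm : MeasurableSet J := hr' measurableSet_Iic
  have hJI : J ⊆ I := fun y hy => hmaps y hy
  have hsplit : θ I = θ J + θ (I \ J) := by
    rw [← measure_inter_add_sdiff I hJm, inter_eq_self_of_subset_right hJI]
  suffices h : ε * θ J ≤ θ A + θ (I \ J) by
    rw [hsplit, add_comm (θ J), ← add_assoc]
    gcongr
  have hεJ : ε * θ J ≤ ε := mul_le_of_le_one_right zero_le prob_le_one
  rcases le_total ε (θ (I \ J)) with hgap | hgap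
  · exact hεJ.trans (hgap.trans le_add_self)
  have hsub : {y | r' y ≤ b' ∧ θ {z | r' z ≤ r' y} ≤ ε - θ (I \ J)} ⊆ A := by
    rintro y ⟨hy, hyε⟩
    refine ⟨⟨hy, hyε.trans tsub_le_self⟩, hmaps y hy, ?_⟩
    calc θ {z | r (g z) ≤ r (g y)} ≤ θ ({z | r' z ≤ r' y} ∪ I \ J) := by
          refine measure_mono fun z hz => ?_
          by_cases hzJ : z ∈ J
          · exact Or.inl (hmono y z hy hzJ hz)
          · exact Or.inr ⟨le_trans hz (hmaps y hy), hzJ⟩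
      _ ≤ θ {z | r' z ≤ r' y} + θ (I \ J) := measure_union_le _ _
      _ ≤ ε - θ (I \ J) + θ (I \ J) := by gcongr
      _ = ε := tsub_add_cancel_of_le hgap
  have hmin := (min_le_measure_distribution_le θ hr' hinj b' (ε - θ (I \ J))).trans
    (measure_mono hsub)
  rcases min_le_iff.1 hmin with h | h
  · calc ε * θ J ≤ ε := hεJ
      _ = ε - θ (I \ J) + θ (I \ J) := (tsub_add_cancel_of_le hgap).symm
      _ ≤ _ := by gcongr
  · calc ε * θ J ≤ θ J := mul_le_of_le_one_left zero_le hε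
      _ ≤ θ A := h
      _ ≤ _ := le_self_add

end Fiber

theorem MeasureTheory.MeasurePreserving.sum_measure_inter_preimage_iterate_le {X : Type*}
    [MeasurableSpace X] {μ : Measure X} {T : X → X} (hT : MeasurePreserving T μ μ) {E B : Set X}
    (hE : MeasurableSet E) (hB : MeasurableSet B) {N : ℕ}
    (hdisj : ∀ d, 0 < d → d < N → Disjoint E (T^[d] ⁻¹' E)) :
    ∑ p ∈ Finset.range N, μ (E ∩ T^[p] ⁻¹' B) ≤ μ B := by
  have hm (j : ℕ) {A : Set X} (hA : MeasurableSet A) : MeasurableSet (T^[j] ⁻¹' A) :=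
    (hT.iterate j).measurable hA
  have hshift : ∀ p ∈ Finset.range N,
      μ (E ∩ T^[p] ⁻¹' B) = μ (T^[N - 1 - p] ⁻¹' E ∩ T^[N - 1] ⁻¹' B) := by
    intro p hp
    rw [Finset.mem_range] at hp
    have h1 : T^[N - 1] = T^[p] ∘ T^[N - 1 - p] := by
      rw [← Function.iterate_add]
      congr 1
      omega
    rw [h1, preimage_comp, ← preimage_inter,
      (hT.iterate _).measure_preimage (hE.inter (hm p hB)).nullMeasurableSet]
  rw [Finset.sum_congr rfl hshift, ← measure_biUnion_finset]
  · refine (measure_mono (t := T^[N - 1] ⁻¹' B) (iUnion₂_subset fun p _ => inter_subset_right)).trans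
      (le_of_eq ((hT.iterate _).measure_preimage hB.nullMeasurableSet))
  · have key : ∀ p p', p < p' → p' < N →
        Disjoint (T^[N - 1 - p] ⁻¹' E ∩ T^[N - 1] ⁻¹' B)
          (T^[N - 1 - p'] ⁻¹' E ∩ T^[N - 1] ⁻¹' B) := by
      intro p p' h h'
      refine Disjoint.mono inter_subset_left inter_subset_left ?_
      have h1 : T^[N - 1 - p] = T^[p' - p] ∘ T^[N - 1 - p'] := by
        rw [← Function.iterate_add]
        congr 1
        omega
      rw [h1, preimage_comp]
      exact (hdisj _ (by omega) (by omega)).symm.preimage _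
    intro p hp p' hp' hne
    rw [Finset.coe_range, mem_Iio] at hp hp'
    rcases lt_or_gt_of_ne hne with h | h
    · exact key p p' h hp'
    · exact (key p' p h hp).symm
  · exact fun p _ => (hm _ hE).inter (hm _ hB)

namespace RepetitivePattern

variable {k : ℕ} {S : SkewSetup k} (P : RepetitivePattern S)

instance isProbabilityMeasure_μX (n : ℕ) : IsProbabilityMeasure (P.μX n) := ⟨by
  have := P.π_pos n
  simp only [μX, Measure.smul_apply, Measure.finsetSum_apply, measure_univ, Finset.sum_const,
    Finset.card_range, smul_eq_mul, nsmul_eq_mul, mul_one]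
  exact ENNReal.inv_mul_cancel (by simp; omega) (by simp)⟩

theorem card_div_le_μX {n : ℕ} {A : Finset ℕ} (hA : A ⊆ Finset.range (P.π n)) {C : Set (SkewM k)}
    (hC : ∀ s ∈ A, S.T^[s] (P.ξp n, P.q n) ∈ C) :
    (A.card : ℝ≥0∞) / P.π n ≤ P.μX n C := by
  rw [μX, Measure.smul_apply, Measure.finsetSum_apply, smul_eq_mul, ENNReal.div_eq_inv_mul]
  gcongr
  calc (A.card : ℝ≥0∞) = ∑ s ∈ A, 1 := by simp
    _ ≤ ∑ s ∈ A, Measure.dirac (S.T^[s] (P.ξp n, P.q n)) C := by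
      refine Finset.sum_le_sum fun s hs => ?_
      rw [Measure.dirac_apply_of_mem (hC s hs)]
    _ ≤ _ := Finset.sum_le_sum_of_subset hA

variable {P} in
theorem le_measure_of_isClosed {μ : Measure (SkewM k)} [IsProbabilityMeasure μ]
    (hμ : WeakStarTendsto (fun n => P.μX n) μ) {C : Set (SkewM k)} (hC : IsClosed C) {c : ℝ≥0∞}
    (h : ∀ᶠ n in atTop, c ≤ P.μX n C) : c ≤ μ C := by
  let μ' : ProbabilityMeasure (SkewM k) := ⟨μ, inferInstance⟩
  let μs : ℕ → ProbabilityMeasure (SkewM k) := fun n => ⟨P.μX n, inferInstance⟩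
  have hlim : Tendsto μs atTop (nhds μ') :=
    ProbabilityMeasure.tendsto_iff_forall_integral_tendsto.2 fun f => hμ f.toContinuousMap
  exact (le_limsup_of_frequently_le h.frequently).trans
    (ProbabilityMeasure.limsup_measure_closed_le_of_tendsto hlim hC)

end RepetitivePattern

section Disintegration

open scoped ProbabilityTheory

variable {k : ℕ} {S : SkewSetup k} {μ : Measure (SkewM k)}

theorem ae_of_ae_fst {p : Shift k → Prop} (h : ∀ᵐ ξ ∂μ.fst, p ξ) : ∀ᵐ z ∂μ, p z.1 :=
  ae_of_ae_map measurable_fst.aemeasurable h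

theorem SkewSetup.measurePreserving_shift (hT : MeasurePreserving S.T μ μ) :
    MeasurePreserving (shiftMap k) μ.fst μ.fst := by
  refine ⟨SkewSetup.continuous_shift.measurable, ?_⟩
  rw [Measure.fst, Measure.map_map SkewSetup.continuous_shift.measurable measurable_fst]
  conv_rhs => rw [← hT.map_eq, Measure.map_map measurable_fst hT.measurable]
  rfl

variable [IsProbabilityMeasure μ]

theorem lintegral_condKernel_section {A : Set (SkewM k)} (hA : MeasurableSet A) :
    ∫⁻ ξ, μ.condKernel ξ (Prod.mk ξ ⁻¹' A) ∂μ.fst = μ A := by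
  rw [← Measure.compProd_apply hA, μ.disintegrate]

theorem measurable_condKernel_section {D : Set (SkewM k × Circle1)} (hD : MeasurableSet D) :
    Measurable fun z : SkewM k => μ.condKernel z.1 (Prod.mk z ⁻¹' D) :=
  ProbabilityTheory.Kernel.measurable_kernel_prodMk_left
    (κ := μ.condKernel.comap Prod.fst measurable_fst) hD

variable (S) in
theorem SkewSetup.measurable_fiber :
    Measurable fun z : SkewM k => S.f (z.1 0) z.2 :=
  S.continuous_T.measurable.snd

theorem SkewSetup.ae_condKernel_shift (hT : MeasurePreserving S.T μ μ) :
    ∀ᵐ ξ ∂μ.fst, μ.condKernel (shiftMap k ξ) = (μ.condKernel ξ).map (S.f (ξ 0)) := by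
  set κ := μ.condKernel with hκ
  have hσ := SkewSetup.measurePreserving_shift hT
  set κ₁ := κ.comap (shiftMap k) hσ.measurable with hκ₁
  set κ₂ := (ProbabilityTheory.Kernel.id ×ₖ κ).map fun z : SkewM k => S.f (z.1 0) z.2 with hκ₂
  have hκ₂' (ξ : Shift k) : κ₂ ξ = (κ ξ).map (S.f (ξ 0)) := by
    rw [hκ₂, ProbabilityTheory.Kernel.map_apply _ S.measurable_fiber,
      ProbabilityTheory.Kernel.prod_apply, ProbabilityTheory.Kernel.id_apply, Measure.dirac_prod,
      Measure.map_map S.measurable_fiber measurable_prodMk_left]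
    rfl
  have hmark : ProbabilityTheory.IsMarkovKernel κ₂ :=
    ProbabilityTheory.Kernel.IsMarkovKernel.map _ S.measurable_fiber
  have hcomp : μ.fst ⊗ₘ κ₁ = μ.fst ⊗ₘ κ₂ := by
    ext A hA
    rw [Measure.compProd_apply hA, Measure.compProd_apply hA]
    set τ : Shift k → Shift k := fun ξ i => ξ (i - 1) with hτ
    have hτm : Measurable τ := measurable_pi_lambda _ fun i => measurable_pi_apply _
    have hτσ (ξ : Shift k) : τ (shiftMap k ξ) = ξ := by
      funext i
      simp [hτ, shiftMap]
    set A' : Set (SkewM k) := (fun z : SkewM k => (τ z.1, z.2)) ⁻¹' A with hA'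
    have hA'm : MeasurableSet A' := ((hτm.comp measurable_fst).prodMk measurable_snd) hA
    calc ∫⁻ ξ, κ₁ ξ (Prod.mk ξ ⁻¹' A) ∂μ.fst
        = ∫⁻ ξ, κ (shiftMap k ξ) (Prod.mk (shiftMap k ξ) ⁻¹' A') ∂μ.fst := by
          refine lintegral_congr fun ξ => ?_
          simp only [hκ₁, hA', ProbabilityTheory.Kernel.comap_apply, ← preimage_comp,
            Function.comp_def, hτσ]
      _ = ∫⁻ ξ, κ ξ (Prod.mk ξ ⁻¹' A') ∂μ.fst :=
          hσ.lintegral_comp (ProbabilityTheory.Kernel.measurable_kernel_prodMk_left hA'm)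
      _ = μ (S.T ⁻¹' A') := by
          rw [lintegral_condKernel_section hA'm, hT.measure_preimage hA'm.nullMeasurableSet]
      _ = ∫⁻ ξ, κ₂ ξ (Prod.mk ξ ⁻¹' A) ∂μ.fst := by
          rw [← lintegral_condKernel_section (hT.measurable hA'm)]
          refine lintegral_congr fun ξ => ?_
          rw [hκ₂', Measure.map_apply (S.f_continuous _).measurable (measurable_prodMk_left hA)]
          simp only [hA', ← preimage_comp, Function.comp_def, SkewSetup.T, hτσ, hκ]
  filter_upwards [ProbabilityTheory.Kernel.ae_eq_of_compProd_eq hcomp] with ξ hξ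
  rw [← hκ₂', ← hξ]
  rfl

theorem SkewSetup.ae_condKernel_shift_iterate (hT : MeasurePreserving S.T μ μ) :
    ∀ᵐ ξ ∂μ.fst, ∀ s, μ.condKernel ((shiftMap k)^[s] ξ) =
      (μ.condKernel ξ).map (S.wordComp (fun i => ξ i) s) := by
  have h : ∀ᵐ ξ ∂μ.fst, ∀ s, μ.condKernel (shiftMap k ((shiftMap k)^[s] ξ)) =
      (μ.condKernel ((shiftMap k)^[s] ξ)).map (S.f ((shiftMap k)^[s] ξ 0)) :=
    ae_all_iff.2 fun s =>
      ((SkewSetup.measurePreserving_shift hT).iterate s).quasiMeasurePreserving.ae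
        (SkewSetup.ae_condKernel_shift hT)
  filter_upwards [h] with ξ hξ s
  induction s with
  | zero => simp [SkewSetup.wordComp]
  | succ s ih =>
    rw [Function.iterate_succ_apply', hξ, ih,
      Measure.map_map (S.f_continuous _).measurable (S.wordComp_continuous _ _).measurable,
      SkewSetup.shift_iterate_apply, zero_add]
    rfl

theorem SkewSetup.measure_inter_preimage_iterate (hT : MeasurePreserving S.T μ μ) (s : ℕ)
    {E : Set (Shift k)} (hE : MeasurableSet E) {Y : Set (SkewM k)} (hY : MeasurableSet Y) :
    μ (Prod.fst ⁻¹' E ∩ S.T^[s] ⁻¹' Y) = ∫⁻ η in E,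
      μ.condKernel ((shiftMap k)^[s] η) (Prod.mk ((shiftMap k)^[s] η) ⁻¹' Y) ∂μ.fst := by
  have hTs := (hT.iterate s).measurable hY
  rw [← lintegral_condKernel_section ((measurable_fst hE).inter hTs), ← lintegral_indicator hE]
  refine lintegral_congr_ae ?_
  filter_upwards [SkewSetup.ae_condKernel_shift_iterate hT] with η hη
  by_cases h : η ∈ E
  · rw [indicator_of_mem h, hη, Measure.map_apply (S.wordComp_continuous _ _).measurable
      (measurable_prodMk_left hY)]
    congr 1
    ext x
    simp [h, S.T_iterate]
  · rw [indicator_of_notMem h]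
    convert measure_empty (μ := μ.condKernel η)
    ext x
    simp [h]

theorem measurableSet_setOf_condKernel_singleton_pos :
    MeasurableSet {z : SkewM k | 0 < μ.condKernel z.1 {z.2}} := by
  have hD : MeasurableSet {p : SkewM k × Circle1 | p.2 = p.1.2} :=
    measurableSet_eq_fun measurable_snd measurable_fst.snd
  exact measurableSet_lt measurable_const (measurable_condKernel_section (μ := μ) hD)

theorem SkewSetup.ae_nullSingletonClass_or_ae_pos (herg : Ergodic S.T μ) :
    (∀ᵐ ξ ∂μ.fst, NullSingletonClass (μ.condKernel ξ)) ∨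
      ∀ᵐ z ∂μ, 0 < μ.condKernel z.1 {z.2} := by
  have hAm := measurableSet_setOf_condKernel_singleton_pos (μ := μ)
  set A := {z : SkewM k | 0 < μ.condKernel z.1 {z.2}} with hA
  have hle : A ≤ᵐ[μ] S.T ⁻¹' A := by
    filter_upwards [ae_of_ae_fst (SkewSetup.ae_condKernel_shift herg.toMeasurePreserving)]
      with z hz hzA
    change 0 < μ.condKernel (shiftMap k z.1) {S.f (z.1 0) z.2}
    rw [hz, Measure.map_apply (S.f_continuous _).measurable (measurableSet_singleton _)]
    refine lt_of_lt_of_le hzA (measure_mono ?_)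
    rintro x rfl
    rfl
  rcases herg.ae_empty_or_univ_of_ae_le_preimage hAm.nullMeasurableSet hle
    with h | h
  · left
    have h0 : μ A = 0 := by rw [measure_congr h, measure_empty]
    rw [← lintegral_condKernel_section hAm, lintegral_eq_zero_iff
      (ProbabilityTheory.Kernel.measurable_kernel_prodMk_left hAm)] at h0
    filter_upwards [h0] with ξ hξ
    refine ⟨fun x => ?_⟩
    by_contra hx
    have hpos : 0 < μ.condKernel ξ {x} := pos_iff_ne_zero.2 hx
    have hle : μ.condKernel ξ {x} ≤ μ.condKernel ξ (Prod.mk ξ ⁻¹' A) :=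
      measure_mono (singleton_subset_iff.2 hpos)
    rw [hξ] at hle
    exact hx (nonpos_iff_eq_zero.1 hle)
  · right
    filter_upwards [h] with z hz
    exact hz.mpr trivial

theorem IsDisintegration.ae_eq_one {md : Shift k → Measure (SkewM k)}
    (hdis : IsDisintegration μ μ.fst md) {A : Set (SkewM k)} (hA : MeasurableSet A)
    (hμA : μ A = 1) : ∀ᵐ ξ ∂μ.fst, md ξ A = 1 := by
  obtain ⟨g, hgm, hg, hgA⟩ := exists_measurable_le_lintegral_eq μ.fst fun ξ => md ξ A
  have h_integral : ∫⁻ ξ, g ξ ∂μ.fst = 1 := by rw [← hgA, ← hdis.2.2 A hA, hμA]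
  have hg1 : g ≤ᵐ[μ.fst] 1 := by
    filter_upwards [hdis.1] with ξ hξ
    exact (hg ξ).trans prob_le_one
  have hge : g =ᵐ[μ.fst] 1 := by
    refine ae_eq_of_ae_le_of_lintegral_le hg1 ?_ aemeasurable_const ?_
    · rw [h_integral]
      exact ENNReal.one_ne_top
    · simp [h_integral]
  filter_upwards [hge, hdis.1] with ξ h1 h2
  refine le_antisymm prob_le_one ?_
  have := hg ξ
  rwa [h1] at this

theorem IsDisintegration.ae_isAtomicMeasure {md : Shift k → Measure (SkewM k)}
    (hdis : IsDisintegration μ μ.fst md) (h : ∀ᵐ z ∂μ, 0 < μ.condKernel z.1 {z.2}) :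
    ∀ᵐ ξ ∂μ.fst, IsAtomicMeasure (md ξ) := by
  have hAm := measurableSet_setOf_condKernel_singleton_pos (μ := μ)
  have hμA : μ {z : SkewM k | 0 < μ.condKernel z.1 {z.2}} = 1 := (prob_compl_eq_zero_iff hAm).1 h
  filter_upwards [hdis.ae_eq_one hAm hμA, hdis.1, hdis.2.1] with ξ h1 h2 h3
  set A := {z : SkewM k | 0 < μ.condKernel z.1 {z.2}} with hA
  refine ⟨A ∩ {ξ} ×ˢ univ, ?_, ?_⟩
  · have hcount : {x | 0 < μ.condKernel ξ {x}}.Countable :=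
      Measure.countable_meas_pos_of_disjoint_iUnion (fun x => measurableSet_singleton x)
        fun x y hxy => disjoint_singleton.2 hxy
    refine (hcount.image (Prod.mk ξ)).mono ?_
    rintro ⟨η, x⟩ ⟨hx, hη, -⟩
    obtain rfl : η = ξ := hη
    exact ⟨x, hx, rfl⟩
  · rw [compl_inter]
    exact measure_union_null ((prob_compl_eq_zero_iff hAm).2 h1)
      ((prob_compl_eq_zero_iff ((measurableSet_singleton ξ).prod .univ)).2 h3)

end Disintegration

/-- The coordinate on the circle with values in `[t, t + 1)`. -/
def circleCoord (t : ℝ) (x : Circle1) : ℝ := AddCircle.equivIco 1 t x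

section CircleCoord

theorem measurable_circleCoord (t : ℝ) : Measurable (circleCoord t) :=
  measurable_subtype_coe.comp (AddCircle.measurableEquivIco 1 t).measurable

theorem circleCoord_injective (t : ℝ) : Function.Injective (circleCoord t) :=
  Subtype.val_injective.comp (AddCircle.equivIco 1 t).injective

theorem le_circleCoord (t : ℝ) (x : Circle1) : t ≤ circleCoord t x :=
  (AddCircle.equivIco 1 t x).2.1

theorem circleCoord_lt (t : ℝ) (x : Circle1) : circleCoord t x < t + 1 :=
  (AddCircle.equivIco 1 t x).2.2

theorem projCircle_circleCoord (t : ℝ) (x : Circle1) : projCircle (circleCoord t x) = x :=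
  (AddCircle.equivIco 1 t).symm_apply_apply x

theorem circleCoord_projCircle {t x : ℝ} (h : t ≤ x) (h' : x < t + 1) :
    circleCoord t (projCircle x) = x := by
  obtain ⟨l, hl⟩ := SkewSetup.projCircle_eq_iff.1 (projCircle_circleCoord t (projCircle x))
  have h1 := le_circleCoord t (projCircle x)
  have h2 := circleCoord_lt t (projCircle x)
  have h3 : (l : ℝ) < 1 := by linarith
  have h4 : (-1 : ℝ) < l := by linarith
  have h5 : l = 0 := by
    have : l < 1 := by exact_mod_cast h3
    have : -1 < l := by exact_mod_cast h4
    omega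
  rw [hl, h5]
  simp

theorem image_projCircle_Icc {a b : ℝ} (h : b - a < 1) :
    projCircle '' Icc a b = {x | circleCoord a x ≤ b} := by
  ext x
  constructor
  · rintro ⟨y, ⟨hy, hy'⟩, rfl⟩
    rw [mem_ofPred_eq, circleCoord_projCircle hy (by linarith)]
    exact hy'
  · intro hx
    exact ⟨_, ⟨le_circleCoord a x, hx⟩, projCircle_circleCoord a x⟩

theorem isClosed_image_projCircle (a b : ℝ) : IsClosed (projCircle '' Icc a b) :=
  (isCompact_Icc.image (AddCircle.continuous_mk' 1)).isClosed

end CircleCoord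

/-- The points of the shift space whose coordinates `0, …, N - 1` follow the sequence `c`. -/
def wordCylinder {k : ℕ} (c : ℕ → Fin k) (N : ℕ) : Set (Shift k) := {ξ | ∀ i < N, ξ (i : ℕ) = c i}

theorem isClosed_wordCylinder {k : ℕ} (c : ℕ → Fin k) (N : ℕ) : IsClosed (wordCylinder c N) := by
  simp only [wordCylinder, ofPred_forall]
  exact isClosed_iInter fun i => isClosed_iInter fun _ =>
    isClosed_eq (continuous_apply _) continuous_const

theorem measurableSet_wordCylinder {k : ℕ} (c : ℕ → Fin k) (N : ℕ) : MeasurableSet (wordCylinder c N) :=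
  (isClosed_wordCylinder c N).measurableSet

namespace RepetitivePattern

variable {k : ℕ} {S : SkewSetup k} (P : RepetitivePattern S)

/-- The coordinate on the circle adapted to the `n`-th interval. -/
def coord (n : ℕ) : Circle1 → ℝ := circleCoord (P.a n)

theorem measurable_coord (n : ℕ) : Measurable (P.coord n) := measurable_circleCoord _

theorem coord_injective (n : ℕ) : Function.Injective (P.coord n) := circleCoord_injective _

theorem exists_coord_wordComp {n m s : ℕ} (h : n ≤ m) (hn : P.b n - P.a n < 1)
    (hs : s ∈ P.starts n m) : ∃ l : ℤ, ∀ x, P.coord m x ≤ P.b m →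
      P.coord n (S.wordComp (P.w m) s x) = S.wordCompLift (P.w m) s (P.coord m x) - l ∧
      P.coord n (S.wordComp (P.w m) s x) ≤ P.b n := by
  obtain ⟨l, hl⟩ := P.exists_int_mapsTo h hs
  refine ⟨l, fun x hx => ?_⟩
  have hmem := hl (P.coord m x) ⟨le_circleCoord (P.a m) x, hx⟩
  have heq : P.coord n (S.wordComp (P.w m) s x) =
      S.wordCompLift (P.w m) s (P.coord m x) - l := by
    rw [← circleCoord_projCircle hmem.1 (by linarith [hmem.2]), SkewSetup.projCircle_sub_int,
      ← S.wordComp_proj, coord, coord, projCircle_circleCoord]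
  exact ⟨heq, heq ▸ hmem.2⟩

theorem coord_wordComp_le {n m s : ℕ} (h : n ≤ m) (hn : P.b n - P.a n < 1)
    (hs : s ∈ P.starts n m) {x : Circle1} (hx : P.coord m x ≤ P.b m) :
    P.coord n (S.wordComp (P.w m) s x) ≤ P.b n := by
  obtain ⟨l, hl⟩ := P.exists_coord_wordComp h hn hs
  exact (hl x hx).2

theorem coord_le_of_coord_wordComp_le {n m s : ℕ} (h : n ≤ m) (hn : P.b n - P.a n < 1)
    (hs : s ∈ P.starts n m) {x y : Circle1} (hx : P.coord m x ≤ P.b m)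
    (hy : P.coord m y ≤ P.b m)
    (hxy : P.coord n (S.wordComp (P.w m) s y) ≤ P.coord n (S.wordComp (P.w m) s x)) :
    P.coord m y ≤ P.coord m x := by
  obtain ⟨l, hl⟩ := P.exists_coord_wordComp h hn hs
  rw [(hl x hx).1, (hl y hy).1, sub_le_sub_iff_right] at hxy
  exact (S.wordCompLift_strictMono _ _).le_iff_le.1 hxy

theorem two_mul_le_π_succ (n : ℕ) : 2 * P.π n ≤ P.π (n + 1) :=
  (Nat.mul_le_mul_right _ (P.kseq_ge n)).trans (P.kseq_mul_le n)

theorem tendsto_π : Tendsto P.π atTop atTop :=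
  (strictMono_nat_of_lt_succ fun n => by
    have := P.two_mul_le_π_succ n
    have := P.π_pos n
    omega).tendsto_atTop

theorem iterate_ξp_mem_wordCylinder {n m s N : ℕ} (h : ∀ i < N, P.cyc m (s + i) = P.cyc n i) :
    (shiftMap k)^[s] (P.ξp m) ∈ wordCylinder (P.cyc n) N := by
  intro i hi
  rw [SkewSetup.shift_iterate_apply, ← h i hi, ← P.ξp_natCast]
  push_cast
  rw [add_comm]

variable {μ : Measure (SkewM k)} [IsProbabilityMeasure μ]

variable {P} in
theorem exists_le_measure_wordCylinder_inter (hμ : WeakStarTendsto (fun n => P.μX n) μ) :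
    ∃ β : ℝ, 0 < β ∧ ∀ n, P.b n - P.a n < 1 → ENNReal.ofReal (β / P.π n) ≤
      μ (Prod.fst ⁻¹' wordCylinder (P.cyc n) (2 * P.π n) ∩ {z | P.coord n z.2 ≤ P.b n}) := by
  obtain ⟨ρ, hρ, hdens⟩ := P.exists_density
  refine ⟨ρ / 2, by positivity, fun n hn => le_measure_of_isClosed hμ ?_ ?_⟩
  · refine ((isClosed_wordCylinder _ _).preimage continuous_fst).inter ?_
    have := (isClosed_image_projCircle (P.a n) (P.b n)).preimage
      (continuous_snd : Continuous (Prod.snd : SkewM k → Circle1))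
    rwa [image_projCircle_Icc hn] at this
  · filter_upwards [eventually_ge_atTop (n + 1)] with m hm
    have hnm : n ≤ m := by omega
    refine le_trans ?_ (P.card_div_le_μX (A := P.dblStarts n m) ?_ ?_)
    · have hπn : (0 : ℝ) < P.π n := by exact_mod_cast P.π_pos n
      have hπm : (0 : ℝ) < P.π m := by exact_mod_cast P.π_pos m
      rw [← ENNReal.ofReal_natCast, ← ENNReal.ofReal_natCast, ← ENNReal.ofReal_div_of_pos hπm]
      refine ENNReal.ofReal_le_ofReal ?_
      have h1 := hdens n m hnm
      have h2 : ((P.starts n m).card : ℝ) ≤ 2 * (P.dblStarts n m).card := by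
        exact_mod_cast P.card_starts_le_two_mul hm
      rw [div_le_div_iff₀ hπn hπm]
      nlinarith
    · intro s hs
      exact Finset.mem_range.2 (P.lt_of_mem_starts hnm (P.dblStarts_subset n m hs))
    · intro s hs
      obtain ⟨hs, hle, hw⟩ := Finset.mem_filter.1 hs
      rw [T_iterate_ξp]
      refine ⟨P.iterate_ξp_mem_wordCylinder fun i hi => ?_, ?_⟩
      · rw [← hw i hi, P.cyc_of_lt (by omega)]
      · have := P.wordComp_cyc_q_mem hnm hs
        rwa [image_projCircle_Icc hn] at this

end RepetitivePattern

section LowSet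

variable {k : ℕ} {S : SkewSetup k} {μ : Measure (SkewM k)} [IsProbabilityMeasure μ]

variable (μ) in
/-- The points whose fiber coordinate `r` has value at most `ε` under the distribution function
of the conditional measure. -/
def lowSet (r : Circle1 → ℝ) (ε : ℝ≥0∞) : Set (SkewM k) :=
  {z | μ.condKernel z.1 {y | r y ≤ r z.2} ≤ ε}

theorem measurableSet_lowSet {r : Circle1 → ℝ} (hr : Measurable r) (ε : ℝ≥0∞) :
    MeasurableSet (lowSet μ r ε) := by
  have hD : MeasurableSet {p : SkewM k × Circle1 | r p.2 ≤ r p.1.2} :=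
    measurableSet_le (hr.comp measurable_snd) (hr.comp measurable_fst.snd)
  exact measurableSet_le (measurable_condKernel_section (μ := μ) hD) measurable_const

theorem measure_inter_preimage_iterate_lowSet_le (hT : MeasurePreserving S.T μ μ)
    (h : ∀ᵐ ξ ∂μ.fst, NullSingletonClass (μ.condKernel ξ)) (s : ℕ) {E : Set (Shift k)}
    (hE : MeasurableSet E) {r : Circle1 → ℝ} (hr : Measurable r) (hinj : Function.Injective r)
    {ε : ℝ≥0∞} (hε : ε ≠ ∞) :
    μ (Prod.fst ⁻¹' E ∩ S.T^[s] ⁻¹' lowSet μ r ε) ≤ ε * μ (Prod.fst ⁻¹' E) := by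
  rw [SkewSetup.measure_inter_preimage_iterate hT s hE (measurableSet_lowSet hr ε)]
  have hae := ((SkewSetup.measurePreserving_shift hT).iterate s).quasiMeasurePreserving.ae h
  calc _ ≤ ∫⁻ _ in E, ε ∂μ.fst := by
        refine lintegral_mono_ae (ae_restrict_of_ae ?_)
        filter_upwards [hae] with η hη
        exact measure_distribution_le_le _ hr hinj hε
    _ = ε * μ (Prod.fst ⁻¹' E) := by
      rw [setLIntegral_const, Measure.fst_apply hE]

end LowSet

namespace RepetitivePattern

variable {k : ℕ} {S : SkewSetup k} {P : RepetitivePattern S} {μ : Measure (SkewM k)}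
  [IsProbabilityMeasure μ]

theorem false_of_eventually_cyc_eq (herg : Ergodic S.T μ)
    (hμ : WeakStarTendsto (fun n => P.μX n) μ)
    (h : ∀ᵐ ξ ∂μ.fst, NullSingletonClass (μ.condKernel ξ)) {n₀ : ℕ}
    (hcyc : ∀ n, n₀ ≤ n → P.cyc n = P.cyc n₀) : False := by
  have hT := herg.toMeasurePreserving
  set c := P.cyc n₀ with hc
  set p := P.π n₀ with hp
  have hp0 : 0 < p := P.π_pos n₀
  set Z : Set (Shift k) := {ξ | ∀ i : ℕ, ξ i = c i} with hZ
  have hZc : IsClosed Z := by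
    simp only [hZ, ofPred_forall]
    exact isClosed_iInter fun i => isClosed_eq (continuous_apply _) continuous_const
  have hZpos : 0 < μ (Prod.fst ⁻¹' Z) := by
    obtain ⟨ρ, hρ, hdens⟩ := P.exists_density
    refine lt_of_lt_of_le (b := ENNReal.ofReal (ρ / p)) ?_
      (le_measure_of_isClosed hμ (hZc.preimage continuous_fst) ?_)
    · rw [ENNReal.ofReal_pos]
      positivity
    · filter_upwards [eventually_ge_atTop n₀] with n hn
      refine le_trans ?_ (P.card_div_le_μX (A := P.starts n₀ n) ?_ ?_)
      · have hπn : (0 : ℝ) < p := by exact_mod_cast hp0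
        have hπm : (0 : ℝ) < P.π n := by exact_mod_cast P.π_pos n
        rw [← ENNReal.ofReal_natCast, ← ENNReal.ofReal_natCast, ← ENNReal.ofReal_div_of_pos hπm]
        refine ENNReal.ofReal_le_ofReal ?_
        rw [div_le_div_iff₀ hπn hπm]
        exact hdens n₀ n hn
      · exact fun s hs => Finset.mem_range.2 (P.lt_of_mem_starts hn hs)
      · intro s hs i
        have hper : Function.Periodic (fun i => c (s + i)) p := fun i => by
          have := P.cyc_periodic n₀ (s + i)
          rwa [add_assoc] at this
        have hmod := Nat.mod_lt i hp0
        have hle := P.add_period_le_of_mem_starts hn hs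
        have h1 : c (s + i % p) = c (i % p) := by
          rw [← hcyc n hn, P.cyc_of_lt (by omega), P.w_add_of_mem_starts hn hs hmod, hcyc n hn]
          exact (P.cyc_of_lt hmod).symm
        rw [T_iterate_ξp]
        change (shiftMap k)^[s] (P.ξp n) i = c i
        rw [SkewSetup.shift_iterate_apply, ← Nat.cast_add, ξp_natCast, hcyc n hn,
          add_comm i s]
        exact (hper.map_mod_nat i).symm.trans (h1.trans ((P.cyc_periodic n₀).map_mod_nat i))
  have hshiftZ : ∀ ξ ∈ Z, (shiftMap k)^[p] ξ ∈ Z := fun ξ hξ i => by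
    rw [SkewSetup.shift_iterate_apply, ← Nat.cast_add, hξ, hc, P.cyc_periodic n₀]
  obtain ⟨t, -, -, l, hl⟩ := P.exists_fixed_lift n₀
  set g := S.wordComp c p with hg
  set r := circleCoord t with hr
  have hrm : Measurable r := measurable_circleCoord t
  have hrinj : Function.Injective r := circleCoord_injective t
  have hG := S.wordCompLift_strictMono c p
  have hrg (y : Circle1) : r (g y) = S.wordCompLift c p (r y) - l := by
    have h1 := hG.monotone (le_circleCoord t y)
    have h2 := hG (circleCoord_lt t y)
    rw [S.wordCompLift_add_one, hl] at h2
    rw [hl] at h1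
    rw [← circleCoord_projCircle (t := t) (x := S.wordCompLift c p (r y) - l)
      (by linarith) (by linarith), SkewSetup.projCircle_sub_int, ← S.wordComp_proj, hr,
      projCircle_circleCoord]
  have hrle (x y : Circle1) : r (g y) ≤ r (g x) ↔ r y ≤ r x := by
    rw [hrg, hrg, sub_le_sub_iff_right, hG.le_iff_le]
  set ε : ℝ≥0∞ := (2 * p : ℝ≥0∞)⁻¹ with hε
  have hp0' : (p : ℝ≥0∞) ≠ 0 := by exact_mod_cast hp0.ne'
  have hε0 : ε ≠ 0 := ENNReal.inv_ne_zero.2 (ENNReal.mul_ne_top (by simp) (by simp))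
  have hεtop : ε ≠ ∞ := ENNReal.inv_ne_top.2 (mul_ne_zero two_ne_zero hp0')
  have hε1 : ε ≤ 1 := by
    rw [hε, ENNReal.inv_le_one]
    exact_mod_cast (by omega : 1 ≤ 2 * p)
  set D : Set (SkewM k) := Prod.fst ⁻¹' Z ∩ lowSet μ r ε with hD
  have hDm : MeasurableSet D := (measurable_fst hZc.measurableSet).inter (measurableSet_lowSet hrm ε)
  have hDle : μ D ≤ ε := by
    have := measure_inter_preimage_iterate_lowSet_le hT h 0 hZc.measurableSet hrm hrinj hεtop
    exact this.trans (mul_le_of_le_one_right' prob_le_one)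
  have hDpos : 0 < μ D := by
    have := SkewSetup.measure_inter_preimage_iterate hT 0 hZc.measurableSet
      (measurableSet_lowSet (μ := μ) hrm ε)
    rw [Function.iterate_zero, preimage_id] at this
    rw [hD, this]
    calc (0 : ℝ≥0∞) < ε * μ (Prod.fst ⁻¹' Z) := ENNReal.mul_pos hε0 hZpos.ne'
      _ = ∫⁻ _ in Z, ε ∂μ.fst := by
        rw [setLIntegral_const, Measure.fst_apply hZc.measurableSet]
      _ ≤ _ := by
        refine lintegral_mono_ae (ae_restrict_of_ae ?_)
        filter_upwards [h] with η hη
        have h1 := min_le_measure_distribution_le (μ.condKernel η) hrm hrinj (t + 1) ε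
        have h2 : {y | r y ≤ t + 1} = univ := eq_univ_of_forall fun y => (circleCoord_lt t y).le
        rw [h2, measure_univ, min_eq_left hε1] at h1
        exact h1.trans (measure_mono fun y hy => hy.2)
  have hDinv : D ≤ᵐ[μ] S.T^[p] ⁻¹' D := by
    filter_upwards [ae_of_ae_fst (SkewSetup.ae_condKernel_shift_iterate hT)] with z hz hzD
    obtain ⟨hzZ, hzL⟩ := hzD
    have hw : S.wordComp (fun i => z.1 i) p = g := S.wordComp_congr fun i _ => hzZ i
    change S.T^[p] z ∈ D
    rw [S.T_iterate, hw]
    refine ⟨hshiftZ _ hzZ, ?_⟩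
    change μ.condKernel ((shiftMap k)^[p] z.1) {y | r y ≤ r (g z.2)} ≤ ε
    have hm : MeasurableSet {y | r y ≤ r (g z.2)} := hrm measurableSet_Iic
    rw [hz, hw, Measure.map_apply (S.wordComp_continuous c p).measurable hm]
    refine (measure_mono fun y hy => ?_).trans hzL
    exact (hrle _ _).1 hy
  set U : Set (SkewM k) := ⋃ i ∈ Finset.range p, S.T^[i] ⁻¹' D with hU
  have hUm : MeasurableSet U :=
    Finset.measurableSet_biUnion _ fun i _ => (hT.iterate i).measurable hDm
  have hUinv : U ≤ᵐ[μ] S.T ⁻¹' U := by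
    filter_upwards [hDinv] with z hz hzU
    obtain ⟨i, hi, hzi⟩ := mem_iUnion₂.1 hzU
    rw [Finset.mem_range] at hi
    have key : ∀ j < p, S.T^[j + 1] z ∈ D → z ∈ S.T ⁻¹' U := fun j hj hz =>
      mem_iUnion₂.2 ⟨j, Finset.mem_range.2 hj, by rwa [Function.iterate_succ_apply] at hz⟩
    rcases i with - | i
    · exact key (p - 1) (by omega) (by rw [Nat.sub_add_cancel hp0]; exact hz hzi)
    · exact key i (by omega) hzi
  have hUpos : 0 < μ U := hDpos.trans_le
    (measure_mono (subset_iUnion₂_of_subset 0 (Finset.mem_range.2 hp0) subset_rfl))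
  have hUlt : μ U < 1 := by
    calc μ U ≤ ∑ i ∈ Finset.range p, μ (S.T^[i] ⁻¹' D) := measure_biUnion_finset_le _ _
      _ ≤ ∑ i ∈ Finset.range p, ε := Finset.sum_le_sum fun i _ => by
        rwa [(hT.iterate i).measure_preimage hDm.nullMeasurableSet]
      _ = 2⁻¹ := by
        rw [Finset.sum_const, Finset.card_range, nsmul_eq_mul, hε,
          ENNReal.mul_inv (by simp) (by simp), mul_left_comm,
          ENNReal.mul_inv_cancel hp0' (by simp), mul_one]
      _ < 1 := ENNReal.inv_lt_one.2 (by norm_num)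
  rcases herg.ae_empty_or_univ_of_ae_le_preimage hUm.nullMeasurableSet hUinv with h0 | h1
  · rw [measure_congr h0, measure_empty] at hUpos
    exact hUpos.ne' rfl
  · rw [measure_congr h1, measure_univ] at hUlt
    exact hUlt.ne rfl

end RepetitivePattern

namespace RepetitivePattern

variable {k : ℕ} {S : SkewSetup k} (P : RepetitivePattern S)

/-- The points whose base itinerary starts with two copies of the `n`-th word. -/
def tower (n : ℕ) : Set (SkewM k) := Prod.fst ⁻¹' wordCylinder (P.cyc n) (2 * P.π n)

/-- The points whose fiber coordinate lies in the `n`-th interval. -/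
def slab (n : ℕ) : Set (SkewM k) := {z | P.coord n z.2 ≤ P.b n}

/-- The points of the `n`-th interval below which the conditional measure has mass at
most `ε`. -/
def lowSlab (μ : Measure (SkewM k)) [IsProbabilityMeasure μ] (ε : ℝ≥0∞) (n : ℕ) :
    Set (SkewM k) := P.slab n ∩ lowSet μ (P.coord n) ε

/-- The points swept out by the low part of the `n`-th tower during one period. -/
def sweep (μ : Measure (SkewM k)) [IsProbabilityMeasure μ] (ε : ℝ≥0∞) (n : ℕ) :
    Set (SkewM k) := ⋃ i ∈ Finset.range (P.π n), S.T^[i] '' (P.tower n ∩ P.lowSlab μ ε n)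

/-- The part of `μ` carried by the orbit segments of length `π n` which start in the low part
of the `n`-th interval, at a position of the `n`-th word inside the `m`-th tower. -/
def lowPart (μ : Measure (SkewM k)) [IsProbabilityMeasure μ] (ε : ℝ≥0∞) (n m : ℕ) :
    Measure (SkewM k) :=
  ∑ s ∈ P.starts n m, ∑ i ∈ Finset.range (P.π n),
    (μ.restrict (P.tower m ∩ S.T^[s] ⁻¹' P.lowSlab μ ε n)).map S.T^[s + i]

theorem measurableSet_tower (n : ℕ) : MeasurableSet (P.tower n) :=
  measurable_fst (measurableSet_wordCylinder _ _)

theorem measurableSet_slab (n : ℕ) : MeasurableSet (P.slab n) :=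
  (P.measurable_coord n).comp measurable_snd measurableSet_Iic

theorem shift_iterate_apply_of_mem_starts {n m s i : ℕ} (h : n ≤ m) (hs : s ∈ P.starts n m)
    {ξ : Shift k} (hξ : ξ ∈ wordCylinder (P.cyc m) (2 * P.π m)) (hi : i < P.π n) :
    (shiftMap k)^[s] ξ i = P.w n i := by
  have := P.add_period_le_of_mem_starts h hs
  rw [SkewSetup.shift_iterate_apply, add_comm, ← Nat.cast_add, hξ _ (by omega),
    P.cyc_of_lt (by omega), P.w_add_of_mem_starts h hs hi]

theorem shift_iterate_mem_wordCylinder {n n' m s t : ℕ} (h' : n' ≤ m)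
    (hs : s ∈ P.starts n' m) (ht : t ∈ P.dblStarts n n') {ξ : Shift k}
    (hξ : ξ ∈ wordCylinder (P.cyc m) (2 * P.π m)) :
    (shiftMap k)^[s + t] ξ ∈ wordCylinder (P.cyc n) (2 * P.π n) := by
  intro i hi
  obtain ⟨-, hle, hw⟩ := Finset.mem_filter.1 ht
  rw [← hw i hi, ← P.shift_iterate_apply_of_mem_starts h' hs hξ (by omega),
    SkewSetup.shift_iterate_apply, SkewSetup.shift_iterate_apply]
  congr 1
  push_cast
  ring

theorem IsPrim.disjoint_tower {n d : ℕ} {P : RepetitivePattern S} (hprim : P.IsPrim n)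
    (hd : 0 < d) (hdn : d < P.π n) : Disjoint (P.tower n) (S.T^[d] ⁻¹' P.tower n) := by
  rw [Set.disjoint_left]
  intro z hz hz'
  refine hprim d hd hdn fun i => ?_
  rw [mem_preimage, S.T_iterate] at hz'
  have hmod := Nat.mod_lt i (P.π_pos n)
  have h1 : (shiftMap k)^[d] z.1 (i % P.π n : ℕ) = P.cyc n (i % P.π n) := hz' _ (by omega)
  have h2 : z.1 (i % P.π n + d : ℕ) = P.cyc n (i % P.π n + d) := hz _ (by omega)
  rw [Nat.cast_add, ← SkewSetup.shift_iterate_apply d z.1, h1] at h2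
  have hper : Function.Periodic (fun i => P.cyc n (i + d)) (P.π n) := fun i => by
    have := P.cyc_periodic n (i + d)
    rwa [add_right_comm] at this
  exact (hper.map_mod_nat i).symm.trans (h2.symm.trans ((P.cyc_periodic n).map_mod_nat i))

section Measure

variable {μ : Measure (SkewM k)} {ε : ℝ≥0∞} {P}

theorem measure_tower_inter_slab_le {n n' m s t : ℕ} (h : n ≤ n') (h' : n' ≤ m)
    (hn : P.b n - P.a n < 1) (hs : s ∈ P.starts n' m) (ht : t ∈ P.starts n n') :
    μ (P.tower m ∩ S.T^[s] ⁻¹' P.slab n') ≤ μ (P.tower m ∩ S.T^[s + t] ⁻¹' P.slab n) := by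
  refine measure_mono fun z hz => ⟨hz.1, ?_⟩
  have h1 := P.lt_of_mem_starts h ht
  obtain ⟨hz, hz'⟩ := hz
  rw [mem_preimage, add_comm, Function.iterate_add_apply]
  rw [mem_preimage, S.T_iterate] at hz'
  rw [S.T_iterate s, S.T_iterate t]
  change P.coord n (S.wordComp _ t _) ≤ P.b n
  rw [S.wordComp_congr (w' := P.w n') fun i hi =>
    P.shift_iterate_apply_of_mem_starts h' hs hz (hi.trans h1)]
  exact P.coord_wordComp_le h hn ht hz'

variable [IsProbabilityMeasure μ]

theorem measurableSet_lowSlab (n : ℕ) : MeasurableSet (P.lowSlab μ ε n) :=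
  (P.measurableSet_slab n).inter (measurableSet_lowSet (P.measurable_coord n) ε)

theorem IsPrim.mul_measure_tower_le {n : ℕ} (hprim : P.IsPrim n)
    (hT : MeasurePreserving S.T μ μ) : P.π n * μ (P.tower n) ≤ 1 := by
  have := hT.sum_measure_inter_preimage_iterate_le (P.measurableSet_tower n) MeasurableSet.univ
    fun d hd hdn => hprim.disjoint_tower hd hdn
  simpa using this

theorem measure_tower_inter_lowSlab_le (hT : MeasurePreserving S.T μ μ)
    (h : ∀ᵐ ξ ∂μ.fst, NullSingletonClass (μ.condKernel ξ)) (hε : ε ≠ ∞) (n m s : ℕ) :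
    μ (P.tower m ∩ S.T^[s] ⁻¹' P.lowSlab μ ε n) ≤ ε * μ (P.tower m) :=
  (measure_mono (inter_subset_inter_right _ (preimage_mono inter_subset_right))).trans
    (measure_inter_preimage_iterate_lowSet_le hT h s (measurableSet_wordCylinder _ _)
      (P.measurable_coord n) (P.coord_injective n) hε)

theorem measurableSet_sweep (n : ℕ) : MeasurableSet (P.sweep μ ε n) :=
  Finset.measurableSet_biUnion _ fun i _ =>
    ((S.continuous_T.measurable.iterate i).measurableEmbedding
      (S.T_injective.iterate i)).measurableSet_image.2
        ((P.measurableSet_tower n).inter (measurableSet_lowSlab n))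

theorem IsPrim.measure_sweep_le {n : ℕ} (hprim : P.IsPrim n) (hT : MeasurePreserving S.T μ μ)
    (h : ∀ᵐ ξ ∂μ.fst, NullSingletonClass (μ.condKernel ξ)) (hε : ε ≠ ∞) :
    μ (P.sweep μ ε n) ≤ ε := by
  have hi (i : ℕ) : μ (S.T^[i] '' (P.tower n ∩ P.lowSlab μ ε n)) ≤ ε * μ (P.tower n) := by
    have hm : MeasurableSet (S.T^[i] '' (P.tower n ∩ P.lowSlab μ ε n)) :=
      ((S.continuous_T.measurable.iterate i).measurableEmbedding
        (S.T_injective.iterate i)).measurableSet_image.2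
          ((P.measurableSet_tower n).inter (measurableSet_lowSlab n))
    rw [← (hT.iterate i).measure_preimage hm.nullMeasurableSet,
      preimage_image_eq _ (S.T_injective.iterate i)]
    exact measure_tower_inter_lowSlab_le hT h hε n n 0
  calc μ (P.sweep μ ε n) ≤ ∑ i ∈ Finset.range (P.π n), ε * μ (P.tower n) :=
        (measure_biUnion_finset_le _ _).trans (Finset.sum_le_sum fun i _ => hi i)
    _ = ε * (P.π n * μ (P.tower n)) := by
      rw [Finset.sum_const, Finset.card_range, nsmul_eq_mul, mul_left_comm]
    _ ≤ ε := mul_le_of_le_one_right' (hprim.mul_measure_tower_le hT)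

theorem lowPart_apply (hT : MeasurePreserving S.T μ μ) (n m : ℕ) {B : Set (SkewM k)}
    (hB : MeasurableSet B) : P.lowPart μ ε n m B = ∑ s ∈ P.starts n m,
      ∑ i ∈ Finset.range (P.π n),
        μ (P.tower m ∩ S.T^[s] ⁻¹' P.lowSlab μ ε n ∩ S.T^[s + i] ⁻¹' B) := by
  simp only [lowPart, Measure.finsetSum_apply]
  refine Finset.sum_congr rfl fun s _ => Finset.sum_congr rfl fun i _ => ?_
  rw [Measure.map_apply (hT.iterate _).measurable hB,
    Measure.restrict_apply ((hT.iterate _).measurable hB), inter_comm]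

theorem IsPrim.lowPart_le {n m : ℕ} (hprim : P.IsPrim m) (h : n ≤ m)
    (hT : MeasurePreserving S.T μ μ) : P.lowPart μ ε n m ≤ μ := by
  refine Measure.le_iff.2 fun B hB => ?_
  rw [lowPart_apply hT n m hB]
  calc _ ≤ ∑ s ∈ P.starts n m, ∑ i ∈ Finset.range (P.π n),
        μ (P.tower m ∩ S.T^[s + i] ⁻¹' B) :=
        Finset.sum_le_sum fun s _ => Finset.sum_le_sum fun i _ =>
          measure_mono (inter_subset_inter_left _ inter_subset_left)
    _ ≤ ∑ p ∈ Finset.range (P.π m), μ (P.tower m ∩ S.T^[p] ⁻¹' B) :=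
      P.sum_starts_le h fun p => μ (P.tower m ∩ S.T^[p] ⁻¹' B)
    _ ≤ μ B := hT.sum_measure_inter_preimage_iterate_le (P.measurableSet_tower m) hB
      fun d hd hdn => hprim.disjoint_tower hd hdn

theorem IsPrim.card_starts_mul_mul_measure_tower_le {n m : ℕ} (hprim : P.IsPrim m) (h : n ≤ m)
    (hT : MeasurePreserving S.T μ μ) :
    (P.starts n m).card * P.π n * μ (P.tower m) ≤ 1 := by
  refine le_trans ?_ (hprim.mul_measure_tower_le hT)
  gcongr
  exact_mod_cast P.card_starts_mul_le h

theorem IsPrim.lowPart_univ_le {n m : ℕ} (hprim : P.IsPrim m) (hnm : n ≤ m)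
    (hT : MeasurePreserving S.T μ μ)
    (h : ∀ᵐ ξ ∂μ.fst, NullSingletonClass (μ.condKernel ξ)) (hε : ε ≠ ∞) :
    P.lowPart μ ε n m univ ≤ ε := by
  rw [lowPart_apply hT n m .univ]
  calc _ ≤ ∑ s ∈ P.starts n m, ∑ i ∈ Finset.range (P.π n), ε * μ (P.tower m) :=
        Finset.sum_le_sum fun s _ => Finset.sum_le_sum fun i _ =>
          (measure_mono inter_subset_left).trans (measure_tower_inter_lowSlab_le hT h hε n m s)
    _ = ε * ((P.starts n m).card * P.π n * μ (P.tower m)) := by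
      simp only [Finset.sum_const, Finset.card_range, nsmul_eq_mul]
      ring
    _ ≤ ε := mul_le_of_le_one_right' (hprim.card_starts_mul_mul_measure_tower_le hnm hT)

theorem IsPrim.lowPart_le_preimage_add {n m : ℕ} (hprim : P.IsPrim m) (hnm : n ≤ m)
    (hT : MeasurePreserving S.T μ μ) {B : Set (SkewM k)} (hB : MeasurableSet B) :
    P.lowPart μ ε n m B ≤ P.lowPart μ ε n m (S.T ⁻¹' B) + (P.π n : ℝ≥0∞)⁻¹ := by
  rw [lowPart_apply hT n m hB, lowPart_apply hT n m (hT.measurable hB)]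
  have hbound : (P.starts n m).card * μ (P.tower m) ≤ (P.π n : ℝ≥0∞)⁻¹ := by
    have hn : (P.π n : ℝ≥0∞) ≠ 0 := by exact_mod_cast (P.π_pos n).ne'
    rw [ENNReal.le_inv_iff_mul_le, mul_right_comm]
    exact hprim.card_starts_mul_mul_measure_tower_le hnm hT
  refine le_trans ?_ (add_le_add_right hbound _)
  rw [← nsmul_eq_mul, ← Finset.sum_const, ← Finset.sum_add_distrib]
  refine Finset.sum_le_sum fun s _ => ?_
  set X := P.tower m ∩ S.T^[s] ⁻¹' P.lowSlab μ ε n with hX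
  have hstep (i : ℕ) : μ (X ∩ S.T^[s + i] ⁻¹' (S.T ⁻¹' B)) = μ (X ∩ S.T^[s + (i + 1)] ⁻¹' B) := by
    rw [← preimage_comp, ← Function.iterate_succ', Nat.succ_eq_add_one, add_assoc]
  simp only [hstep]
  calc _ ≤ ∑ i ∈ Finset.range (P.π n + 1), μ (X ∩ S.T^[s + i] ⁻¹' B) :=
        Finset.sum_le_sum_of_subset (Finset.range_mono (Nat.le_succ _))
    _ = ∑ i ∈ Finset.range (P.π n), μ (X ∩ S.T^[s + (i + 1)] ⁻¹' B) +
        μ (X ∩ S.T^[s + 0] ⁻¹' B) := Finset.sum_range_succ' _ _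
    _ ≤ _ := by
      gcongr
      exact inter_subset_left.trans inter_subset_left

theorem mul_sum_measure_le_lowPart_sweep (hT : MeasurePreserving S.T μ μ) {n n' m : ℕ}
    (h : n ≤ n') (h' : n' ≤ m) :
    P.π n * ∑ s ∈ P.starts n' m, ∑ t ∈ P.dblStarts n n',
      μ (P.tower m ∩ S.T^[s] ⁻¹' (P.lowSlab μ ε n' ∩ S.T^[t] ⁻¹' P.lowSlab μ ε n)) ≤
    P.lowPart μ ε n' m (P.sweep μ ε n) := by
  rw [lowPart_apply hT n' m (measurableSet_sweep n), Finset.mul_sum]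
  refine Finset.sum_le_sum fun s hs => ?_
  set X := P.tower m ∩ S.T^[s] ⁻¹' P.lowSlab μ ε n' with hX
  calc _ ≤ ∑ t ∈ P.dblStarts n n', ∑ j ∈ Finset.range (P.π n),
        μ (X ∩ S.T^[s + (t + j)] ⁻¹' P.sweep μ ε n) := by
        rw [Finset.mul_sum]
        refine Finset.sum_le_sum fun t ht => ?_
        rw [← nsmul_eq_mul, ← Finset.card_range (P.π n), ← Finset.sum_const, Finset.card_range]
        refine Finset.sum_le_sum fun j hj => measure_mono fun z hz => ?_
        obtain ⟨hz1, hz2, hz3⟩ := hz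
        refine ⟨⟨hz1, hz2⟩, mem_iUnion₂.2 ⟨j, hj, S.T^[s + t] z, ⟨?_, ?_⟩, ?_⟩⟩
        · rw [S.T_iterate]
          exact P.shift_iterate_mem_wordCylinder h' hs ht hz1
        · rw [add_comm, Function.iterate_add_apply]
          exact hz3
        · rw [← Function.iterate_add_apply]
          rw [show j + (s + t) = s + (t + j) by omega]
    _ ≤ ∑ t ∈ P.starts n n', ∑ j ∈ Finset.range (P.π n),
        μ (X ∩ S.T^[s + (t + j)] ⁻¹' P.sweep μ ε n) :=
      Finset.sum_le_sum_of_subset (P.dblStarts_subset n n')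
    _ ≤ _ := P.sum_starts_le h fun i => μ (X ∩ S.T^[s + i] ⁻¹' P.sweep μ ε n)

theorem mul_add_measure_tower_inter_slab_le (hT : MeasurePreserving S.T μ μ)
    (hκ : ∀ᵐ ξ ∂μ.fst, NullSingletonClass (μ.condKernel ξ)) (hε : ε ≤ 1) {n n' m s t : ℕ}
    (h : n ≤ n') (h' : n' ≤ m) (hn : P.b n - P.a n < 1) (hs : s ∈ P.starts n' m)
    (ht : t ∈ P.starts n n') :
    ε * μ (P.tower m ∩ S.T^[s] ⁻¹' P.slab n') + μ (P.tower m ∩ S.T^[s] ⁻¹' P.slab n') ≤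
      μ (P.tower m ∩ S.T^[s] ⁻¹' (P.lowSlab μ ε n' ∩ S.T^[t] ⁻¹' P.lowSlab μ ε n)) +
        μ (P.tower m ∩ S.T^[s + t] ⁻¹' P.slab n) := by
  have hE := measurableSet_wordCylinder (P.cyc m) (2 * P.π m)
  have hm {Y : Set (SkewM k)} (hY : MeasurableSet Y) : Measurable fun η : Shift k =>
      μ.condKernel ((shiftMap k)^[s] η) (Prod.mk ((shiftMap k)^[s] η) ⁻¹' Y) :=
    (ProbabilityTheory.Kernel.measurable_kernel_prodMk_left hY).comp
      (SkewSetup.continuous_shift.measurable.iterate s)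
  have hY1 : MeasurableSet (S.T^[t] ⁻¹' P.slab n) := (hT.iterate t).measurable (P.measurableSet_slab n)
  have hY2 : MeasurableSet (P.lowSlab μ ε n' ∩ S.T^[t] ⁻¹' P.lowSlab μ ε n) :=
    (measurableSet_lowSlab n').inter ((hT.iterate t).measurable (measurableSet_lowSlab n))
  have hcomp : S.T^[s + t] ⁻¹' P.slab n = S.T^[s] ⁻¹' (S.T^[t] ⁻¹' P.slab n) := by
    rw [← preimage_comp, ← Function.iterate_add, add_comm]
  have hlt := P.lt_of_mem_starts h ht
  rw [hcomp]
  simp only [tower]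
  rw [SkewSetup.measure_inter_preimage_iterate hT s hE (P.measurableSet_slab n'),
    SkewSetup.measure_inter_preimage_iterate hT s hE hY1,
    SkewSetup.measure_inter_preimage_iterate hT s hE hY2,
    ← lintegral_const_mul _ (hm (P.measurableSet_slab n')),
    ← lintegral_add_right _ (hm (P.measurableSet_slab n')), ← lintegral_add_right _ (hm hY1)]
  have hae := ((SkewSetup.measurePreserving_shift hT).iterate s).quasiMeasurePreserving.ae
    (hκ.and (SkewSetup.ae_condKernel_shift_iterate hT))
  refine lintegral_mono_ae ((ae_restrict_iff' hE).2 ?_)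
  filter_upwards [hae] with η hη hηE
  have := hη.1
  have hmap := hη.2 t
  have hw : S.wordComp (fun i => (shiftMap k)^[s] η i) t = S.wordComp (P.w n') t :=
    S.wordComp_congr fun i hi => P.shift_iterate_apply_of_mem_starts h' hs hηE (hi.trans hlt)
  rw [hw] at hmap
  set ξ := (shiftMap k)^[s] η with hξ
  set g := S.wordComp (P.w n') t with hg
  have hTt (y : Circle1) : S.T^[t] (ξ, y) = ((shiftMap k)^[t] ξ, g y) := by
    rw [S.T_iterate, hw]
  refine (mul_add_measure_le_of_monotone (μ.condKernel ξ) (P.measurable_coord n')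
    (P.coord_injective n') (fun y hy => P.coord_wordComp_le h hn ht hy)
    (fun y z hy hz hyz => P.coord_le_of_coord_wordComp_le h hn ht hy hz hyz) hε).trans_eq ?_
  congr 2
  · ext y
    have hmy : MeasurableSet {z | P.coord n z ≤ P.coord n (g y)} :=
      P.measurable_coord n measurableSet_Iic
    simp only [mem_preimage, mem_inter_iff, lowSlab, slab, lowSet, hTt, mem_ofPred_eq, hmap]
    rw [Measure.map_apply (S.wordComp_continuous _ _).measurable hmy]
    rfl
  · ext y
    simp only [mem_preimage, slab, hTt, mem_ofPred_eq]
    rfl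

end Measure

end RepetitivePattern

namespace RepetitivePattern

variable {k : ℕ} {S : SkewSetup k} (P : RepetitivePattern S)

/-- The total measure, over all positions of the `n`-th word inside the `m`-th tower, of the part
of the tower lying in the `n`-th interval at this position. -/
def slabSum (μ : Measure (SkewM k)) (n m : ℕ) : ℝ≥0∞ :=
  ∑ s ∈ P.starts n m, μ (P.tower m ∩ S.T^[s] ⁻¹' P.slab n)

/-- The average, over all positions of the `n`-th word inside the `m`-th tower, of the part
of the tower lying in the `n`-th interval at this position, normalized by the period. -/
def slabMean (μ : Measure (SkewM k)) (n m : ℕ) : ℝ :=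
  P.π m * (P.slabSum μ n m).toReal / (P.starts n m).card

variable {P} {μ : Measure (SkewM k)} [IsProbabilityMeasure μ]

theorem slabSum_ne_top (n m : ℕ) : P.slabSum μ n m ≠ ∞ :=
  ENNReal.sum_ne_top.2 fun _ _ => measure_ne_top _ _

theorem mul_slabSum_add_le (hT : MeasurePreserving S.T μ μ)
    (hκ : ∀ᵐ ξ ∂μ.fst, NullSingletonClass (μ.condKernel ξ)) {ε : ℝ≥0∞} (hε : ε ≤ 1) {n n' m : ℕ}
    (h : n ≤ n') (h' : n' ≤ m) (hn : P.b n - P.a n < 1) :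
    ε * (P.dblStarts n n').card * P.slabSum μ n' m + (P.starts n n').card * P.slabSum μ n' m ≤
      ∑ s ∈ P.starts n' m, ∑ t ∈ P.dblStarts n n',
        μ (P.tower m ∩ S.T^[s] ⁻¹' (P.lowSlab μ ε n' ∩ S.T^[t] ⁻¹' P.lowSlab μ ε n)) +
      P.slabSum μ n m := by
  rw [slabSum, slabSum, P.sum_starts h h', Finset.mul_sum, Finset.mul_sum,
    ← Finset.sum_add_distrib, ← Finset.sum_add_distrib]
  refine Finset.sum_le_sum fun s hs => ?_
  rw [← Finset.sum_sdiff (P.dblStarts_subset n n'),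
    ← Finset.card_sdiff_add_card_eq_card (P.dblStarts_subset n n')]
  set x := μ (P.tower m ∩ S.T^[s] ⁻¹' P.slab n') with hx
  have h1 : ((P.starts n n' \ P.dblStarts n n').card : ℝ≥0∞) * x ≤
      ∑ t ∈ P.starts n n' \ P.dblStarts n n', μ (P.tower m ∩ S.T^[s + t] ⁻¹' P.slab n) := by
    rw [← nsmul_eq_mul, ← Finset.sum_const]
    exact Finset.sum_le_sum fun t ht =>
      measure_tower_inter_slab_le h h' hn hs (Finset.mem_sdiff.1 ht).1
  have h2 : ((P.dblStarts n n').card : ℝ≥0∞) * (ε * x + x) ≤ ∑ t ∈ P.dblStarts n n',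
      (μ (P.tower m ∩ S.T^[s] ⁻¹' (P.lowSlab μ ε n' ∩ S.T^[t] ⁻¹' P.lowSlab μ ε n)) +
        μ (P.tower m ∩ S.T^[s + t] ⁻¹' P.slab n)) := by
    rw [← nsmul_eq_mul, ← Finset.sum_const]
    exact Finset.sum_le_sum fun t ht =>
      mul_add_measure_tower_inter_slab_le hT hκ hε h h' hn hs (P.dblStarts_subset n n' ht)
  rw [Finset.sum_add_distrib] at h2
  refine le_trans (le_of_eq ?_) ((add_le_add h1 h2).trans (le_of_eq ?_))
  · push_cast
    ring
  · ring

theorem slabMean_le_one {n m : ℕ} (hprim : P.IsPrim m) (h : n ≤ m)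
    (hT : MeasurePreserving S.T μ μ) : P.slabMean μ n m ≤ 1 := by
  have hc : (0 : ℝ) < (P.starts n m).card := by exact_mod_cast P.card_starts_pos h
  have h1 : P.slabSum μ n m ≤ (P.starts n m).card * μ (P.tower m) := by
    rw [slabSum, ← nsmul_eq_mul, ← Finset.sum_const]
    exact Finset.sum_le_sum fun s _ => measure_mono inter_subset_left
  have h2 : (P.slabSum μ n m).toReal ≤ (P.starts n m).card * (μ (P.tower m)).toReal := by
    have := ENNReal.toReal_mono (by finiteness) h1
    simpa using this
  have h3 : P.π m * (μ (P.tower m)).toReal ≤ 1 := by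
    have := ENNReal.toReal_mono (by simp) (hprim.mul_measure_tower_le hT)
    simpa using this
  rw [slabMean, div_le_one hc]
  calc P.π m * (P.slabSum μ n m).toReal
      ≤ P.π m * ((P.starts n m).card * (μ (P.tower m)).toReal) := by gcongr
    _ = (P.starts n m).card * (P.π m * (μ (P.tower m)).toReal) := by ring
    _ ≤ (P.starts n m).card := mul_le_of_le_one_right hc.le h3

theorem le_slabMean {n m : ℕ} (h : n ≤ m) (hn : P.b n - P.a n < 1) {β : ℝ}
    (hβ : ENNReal.ofReal (β / P.π m) ≤ μ (P.tower m ∩ P.slab m)) : β ≤ P.slabMean μ n m := by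
  have hc : (0 : ℝ) < (P.starts n m).card := by exact_mod_cast P.card_starts_pos h
  have hπ : (0 : ℝ) < P.π m := by exact_mod_cast P.π_pos m
  have h1 : (P.starts n m).card * ENNReal.ofReal (β / P.π m) ≤ P.slabSum μ n m := by
    rw [slabSum, ← nsmul_eq_mul, ← Finset.sum_const]
    refine Finset.sum_le_sum fun s hs => hβ.trans ?_
    have := measure_tower_inter_slab_le (μ := μ) (s := 0) h le_rfl hn (by simp [starts_self]) hs
    simpa using this
  have h2 : (P.starts n m).card * (β / P.π m) ≤ (P.slabSum μ n m).toReal := by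
    have := ENNReal.toReal_mono (slabSum_ne_top n m) h1
    rw [ENNReal.toReal_mul, ENNReal.toReal_natCast] at this
    refine le_trans ?_ this
    gcongr
    rw [ENNReal.toReal_ofReal']
    exact le_max_left _ _
  rw [slabMean, le_div_iff₀ hc]
  calc β * (P.starts n m).card = P.π m * ((P.starts n m).card * (β / P.π m)) := by
        field_simp
    _ ≤ _ := by gcongr

theorem mul_sub_le_lowPart_sweep (hT : MeasurePreserving S.T μ μ)
    (hκ : ∀ᵐ ξ ∂μ.fst, NullSingletonClass (μ.condKernel ξ)) {e ρ η : ℝ} (he : 0 ≤ e) (he1 : e ≤ 1)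
    {n n' m : ℕ} (h : n < n') (h' : n' ≤ m) (hn : P.b n - P.a n < 1) (hprim : P.IsPrim m)
    (hρ : ρ * P.π m ≤ (P.starts n m).card * P.π n)
    (hη : P.slabMean μ n m - P.slabMean μ n' m ≤ η)
    (hη' : η ≤ e / 2 * P.slabMean μ n' m) :
    ρ * (e / 2 * P.slabMean μ n' m - η) ≤
      (P.lowPart μ (ENNReal.ofReal e) n' m).real (P.sweep μ (ENNReal.ofReal e) n) := by
  set ε := ENNReal.ofReal e with hε
  have hε1 : ε ≤ 1 := by simpa [hε] using he1
  set A := ∑ s ∈ P.starts n' m, ∑ t ∈ P.dblStarts n n',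
    μ (P.tower m ∩ S.T^[s] ⁻¹' (P.lowSlab μ ε n' ∩ S.T^[t] ⁻¹' P.lowSlab μ ε n)) with hA
  have hAtop : A ≠ ∞ :=
    ENNReal.sum_ne_top.2 fun _ _ => ENNReal.sum_ne_top.2 fun _ _ => measure_ne_top _ _
  have hfin : IsFiniteMeasure (P.lowPart μ ε n' m) :=
    isFiniteMeasure_of_le μ (hprim.lowPart_le h' hT)
  have hAΛ : P.π n * A.toReal ≤ (P.lowPart μ ε n' m).real (P.sweep μ ε n) := by
    have := ENNReal.toReal_mono (measure_ne_top (P.lowPart μ ε n' m) _)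
      (mul_sum_measure_le_lowPart_sweep (ε := ε) hT h.le h')
    rwa [ENNReal.toReal_mul, ENNReal.toReal_natCast] at this
  set x := (P.slabSum μ n m).toReal with hx
  set y := (P.slabSum μ n' m).toReal with hy
  have hxy : e * (P.dblStarts n n').card * y + (P.starts n n').card * y ≤ A.toReal + x := by
    have := ENNReal.toReal_mono (ENNReal.add_ne_top.2 ⟨hAtop, slabSum_ne_top n m⟩)
      (mul_slabSum_add_le hT hκ hε1 h.le h' hn)
    have h1 := slabSum_ne_top (P := P) (μ := μ) n' m
    rwa [ENNReal.toReal_add hAtop (slabSum_ne_top n m), ENNReal.toReal_add (by finiteness)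
      (by finiteness), ENNReal.toReal_mul, ENNReal.toReal_mul, ENNReal.toReal_mul,
      ENNReal.toReal_ofReal he, ENNReal.toReal_natCast, ENNReal.toReal_natCast] at this
  have hπm : (0 : ℝ) < P.π m := by exact_mod_cast P.π_pos m
  have hπn : (0 : ℝ) < P.π n := by exact_mod_cast P.π_pos n
  have hc' : (0 : ℝ) < (P.starts n' m).card := by exact_mod_cast P.card_starts_pos h'
  have hst : (0 : ℝ) < (P.starts n n').card := by exact_mod_cast P.card_starts_pos h.le
  have hc : ((P.starts n m).card : ℝ) = (P.starts n' m).card * (P.starts n n').card := by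
    exact_mod_cast P.card_starts_mul h.le h'
  have hdbl : ((P.starts n n').card : ℝ) ≤ 2 * (P.dblStarts n n').card := by
    exact_mod_cast P.card_starts_le_two_mul h
  have hy0 : 0 ≤ y := ENNReal.toReal_nonneg
  have hlow : e / 2 * ((P.starts n n').card * y) + (P.starts n n').card * y - x ≤ A.toReal := by
    have : e * y * (P.starts n n').card ≤ e * y * (2 * (P.dblStarts n n').card) := by gcongr
    nlinarith
  have hmean : (P.starts n m).card * P.slabMean μ n m = P.π m * x := by
    rw [slabMean]
    have : (0 : ℝ) < (P.starts n m).card := by rw [hc]; positivity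
    field_simp
    rfl
  have hmean' : (P.starts n m).card * P.slabMean μ n' m =
      P.π m * ((P.starts n n').card * y) := by
    rw [slabMean, hc]
    field_simp
    rfl
  refine le_of_mul_le_mul_left ?_ hπm
  set c : ℝ := ((P.starts n m).card : ℝ)
  set M := P.slabMean μ n m with hM
  set M' := P.slabMean μ n' m with hM'
  calc P.π m * (ρ * (e / 2 * M' - η)) = ρ * P.π m * (e / 2 * M' - η) := by ring
    _ ≤ c * P.π n * (e / 2 * M' - η) := by
      have : 0 ≤ e / 2 * M' - η := by linarith
      gcongr
    _ ≤ c * P.π n * (e / 2 * M' - (M - M')) := by gcongr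
    _ = P.π n * (e / 2 * (c * M') + c * M' - c * M) := by ring
    _ = P.π m * (P.π n * (e / 2 * ((P.starts n n').card * y) + (P.starts n n').card * y - x)) := by
      rw [hmean, hmean']
      ring
    _ ≤ P.π m * (P.π n * A.toReal) := by gcongr
    _ ≤ _ := by gcongr

theorem false_of_frequently_isPrim (herg : Ergodic S.T μ)
    (hμ : WeakStarTendsto (fun n => P.μX n) μ)
    (hκ : ∀ᵐ ξ ∂μ.fst, NullSingletonClass (μ.condKernel ξ))
    (hprim : ∀ N, ∃ n, N ≤ n ∧ P.IsPrim n) : False := by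
  have hT := herg.toMeasurePreserving
  obtain ⟨ρ, hρ, hdens⟩ := P.exists_density
  obtain ⟨β, hβ, hcyl⟩ := exists_le_measure_wordCylinder_inter hμ
  set e := min 1 (ρ * β / 16) with he
  have he0 : 0 < e := lt_min one_pos (by positivity)
  have he1 : e ≤ 1 := min_le_left _ _
  have he2 : 16 * e ≤ ρ * β := by
    have := min_le_right 1 (ρ * β / 16)
    linarith
  set ε := ENNReal.ofReal e with hε
  have hεtop : ε ≠ ∞ := ENNReal.ofReal_ne_top
  have hδ (n : ℕ) := herg.exists_pos_forall_real_le (measurableSet_sweep (P := P) (μ := μ) (ε := ε) n)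
    (pow_pos he0 2)
  choose δ hδ0 hδ using hδ
  have hlen : ∀ᶠ n in atTop, P.b n - P.a n < 1 := P.len_to_zero.eventually_lt_const one_pos
  obtain ⟨N₀, hN₀⟩ := eventually_atTop.1 hlen
  have hnext (n : ℕ) : ∃ n', n < n' ∧ P.IsPrim n' ∧ P.b n' - P.a n' < 1 ∧
      (P.π n' : ℝ)⁻¹ ≤ δ n := by
    have hlim : Tendsto (fun n => (P.π n : ℝ)⁻¹) atTop (nhds 0) :=
      tendsto_inv_atTop_zero.comp (tendsto_natCast_atTop_atTop.comp P.tendsto_π)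
    obtain ⟨N₁, hN₁⟩ := eventually_atTop.1 (hlim.eventually_lt_const (hδ0 n))
    obtain ⟨n', hn', hp⟩ := hprim (max (n + 1) (max N₀ N₁))
    simp only [max_le_iff] at hn'
    exact ⟨n', hn'.1, hp, hN₀ _ hn'.2.1, (hN₁ _ hn'.2.2).le⟩
  choose next hlt hnprim hnlen hnδ using hnext
  set u : ℕ → ℕ := fun i => next^[i + 1] 0 with hu
  have husucc (i : ℕ) : u (i + 1) = next (u i) := Function.iterate_succ_apply' next (i + 1) 0
  have huprim (i : ℕ) : P.IsPrim (u i) := by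
    rw [hu]
    simp only [Function.iterate_succ_apply']
    exact hnprim _
  have hulen (i : ℕ) : P.b (u i) - P.a (u i) < 1 := by
    rw [hu]
    simp only [Function.iterate_succ_apply']
    exact hnlen _
  have humono : StrictMono u := strictMono_nat_of_lt_succ fun i => by
    rw [husucc]
    exact hlt _
  set η := e * β / 4 with hη
  have hη0 : 0 < η := by positivity
  obtain ⟨K, hK⟩ := exists_nat_gt (1 / η)
  rw [div_lt_iff₀ hη0] at hK
  set m := u K with hm
  have hβm := hcyl m (hulen K)
  have hmean (i : ℕ) (hi : i ≤ K) : β ≤ P.slabMean μ (u i) m :=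
    le_slabMean (humono.monotone hi) (hulen i) hβm
  obtain ⟨i, hi, hdiff⟩ : ∃ i < K, P.slabMean μ (u i) m - P.slabMean μ (u (i + 1)) m ≤ η := by
    by_contra! hcon
    have hsum : ∑ i ∈ Finset.range K, η ≤
        ∑ i ∈ Finset.range K, (P.slabMean μ (u i) m - P.slabMean μ (u (i + 1)) m) :=
      Finset.sum_le_sum fun i hi => (hcon i (Finset.mem_range.1 hi)).le
    rw [Finset.sum_range_sub', Finset.sum_const, Finset.card_range, nsmul_eq_mul] at hsum
    have h1 := slabMean_le_one (huprim K) (humono.monotone (Nat.zero_le K)) hT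
    have h2 := hmean K le_rfl
    linarith
  have hi' : i + 1 ≤ K := hi
  set n := u i with hn
  set n' := u (i + 1) with hn'
  have hn'm : n' ≤ m := humono.monotone hi'
  have hnn' : n < n' := humono i.lt_succ_self
  have hM' : β ≤ P.slabMean μ n' m := hmean (i + 1) hi'
  have hbracket : e / 2 * β ≤ e / 2 * P.slabMean μ n' m := by gcongr
  have hlower := mul_sub_le_lowPart_sweep hT hκ he0.le he1 hnn' hn'm (hulen i) (huprim K)
    (hdens n m (hnn'.le.trans hn'm)) hdiff (by linarith)
  have hΛle : P.lowPart μ ε n' m ≤ μ := (huprim K).lowPart_le hn'm hT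
  have hfin : IsFiniteMeasure (P.lowPart μ ε n' m) := isFiniteMeasure_of_le μ hΛle
  have hupper := hδ n _ hΛle fun B hB => by
    have hinv : (P.π n' : ℝ≥0∞)⁻¹ ≠ ∞ :=
      ENNReal.inv_ne_top.2 (by exact_mod_cast (P.π_pos n').ne')
    have hfinB := measure_ne_top (P.lowPart μ ε n' m) (S.T ⁻¹' B)
    have h1 := ENNReal.toReal_mono (ENNReal.add_ne_top.2 ⟨hfinB, hinv⟩)
      ((huprim K).lowPart_le_preimage_add (ε := ε) hn'm hT hB)
    rw [ENNReal.toReal_add hfinB hinv, ENNReal.toReal_inv, ENNReal.toReal_natCast] at h1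
    have h2 : (P.π n' : ℝ)⁻¹ ≤ δ n := by
      rw [hn', husucc]
      exact hnδ n
    exact h1.trans (add_le_add_right h2 _)
  have hΛuniv : (P.lowPart μ ε n' m).real univ ≤ e :=
    ENNReal.toReal_le_of_le_ofReal he0.le ((huprim K).lowPart_univ_le hn'm hT hκ hεtop)
  have hsweep : μ.real (P.sweep μ ε n) ≤ e :=
    ENNReal.toReal_le_of_le_ofReal he0.le ((huprim i).measure_sweep_le hT hκ hεtop)
  have hprod : (P.lowPart μ ε n' m).real univ * μ.real (P.sweep μ ε n) ≤ e * e := by gcongr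
  have hge : ρ * (e * β / 4) ≤ ρ * (e / 2 * P.slabMean μ n' m - η) := by
    gcongr
    linarith
  nlinarith

end RepetitivePattern

/-- A `T`-invariant ergodic probability measure with periodic repetitive
pattern has atomic disintegration along the vertical fibers: for `ν`-a.e. base point the
conditional measure is purely atomic. -/
theorem atomicDisintegration_of_ergodic_periodicRepetitivePattern
    {k : ℕ} (S : SkewSetup k) (μ : Measure (SkewM k))
    (hprob : IsProbabilityMeasure μ)
    (herg : Ergodic S.T μ)
    (hpat : HasPeriodicRepetitivePattern S μ)
    (md : Shift k → Measure (SkewM k))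
    (hdis : IsDisintegration μ (μ.map Prod.fst) md) :
    ∀ᵐ ξ ∂(μ.map Prod.fst), IsAtomicMeasure (md ξ) := by
  obtain ⟨P, hμ⟩ := hpat
  rcases SkewSetup.ae_nullSingletonClass_or_ae_pos herg with hκ | hpos
  · rcases P.frequently_isPrim_or_eventually_cyc_eq with hprim | ⟨n₀, hcyc⟩
    · exact (RepetitivePattern.false_of_frequently_isPrim herg hμ hκ hprim).elim
    · exact (RepetitivePattern.false_of_eventually_cyc_eq herg hμ hκ hcyc).elim
  · exact hdis.ae_isAtomicMeasure hpos

end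
end

section
/- Let (X,d) be a compact metric space and let x, y ∈ X^ℕ be periodic sequences with a common period N (i.e. x_{i+N} = x_i and y_{i+N} = y_i for all i). Then for every δ > 0 the limit lim_{m→∞} f̄_{mN,δ}(x,y) exists and equals f̄_δ(x,y) = limsup_{n→∞} f̄_{n,δ}(x,y). -/
open MeasureTheory Filter Set
open scoped ENNReal NNReal

noncomputable section

/-- An `(n,δ)`-match between the sequences `x` and `y`, for the distance function `d`:
an order-preserving bijection `p` from `D` onto `R`, with `D, R ⊆ {0, …, n-1}`, such that
`d (x i) (y (p i)) < δ` for all `i ∈ D`.  The fit size of the match is `D.card`. -/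
def IsMatch {X : Type*} (d : X → X → ℝ) (x y : ℕ → X) (n : ℕ) (δ : ℝ)
    (D R : Finset ℕ) (p : ℕ → ℕ) : Prop :=
  (∀ i ∈ D, i < n) ∧ (∀ j ∈ R, j < n) ∧ Set.BijOn p ↑D ↑R ∧
  (∀ i ∈ D, ∀ j ∈ D, i < j → p i < p j) ∧ (∀ i ∈ D, d (x i) (y (p i)) < δ)

/-- The maximal fit size of an `(n,δ)`-match between `x` and `y`. -/
def maxFit {X : Type*} (d : X → X → ℝ) (x y : ℕ → X) (n : ℕ) (δ : ℝ) : ℕ :=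
  sSup {m : ℕ | ∃ D R p, IsMatch d x y n δ D R p ∧ D.card = m}

/-- The `(n,δ)`-gap function `f̄_{n,δ}(x,y)`. -/
def gapFn {X : Type*} (d : X → X → ℝ) (x y : ℕ → X) (n : ℕ) (δ : ℝ) : ℝ :=
  1 - (maxFit d x y n δ : ℝ) / n

/-- The `f̄_δ`-pseudo-distance: `f̄_δ(x,y) = limsup_n f̄_{n,δ}(x,y)`. -/
def gapDist {X : Type*} (d : X → X → ℝ) (x y : ℕ → X) (δ : ℝ) : ℝ :=
  Filter.limsup (fun n => gapFn d x y n δ) Filter.atTop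

/-- The Feldman–Katok pseudometric `F̄_K(x,y) = inf {δ > 0 : f̄_δ(x,y) < δ}`. -/
def FKdist {X : Type*} (d : X → X → ℝ) (x y : ℕ → X) : ℝ :=
  sInf {δ : ℝ | 0 < δ ∧ gapDist d x y δ < δ}


section Matching

variable {X : Type*} {d : X → X → ℝ} {x y : ℕ → X} {δ : ℝ}

theorem IsMatch.card_le {n : ℕ} {D R : Finset ℕ} {p : ℕ → ℕ}
    (h : IsMatch d x y n δ D R p) : D.card ≤ n := by
  have hD : D ⊆ Finset.range n := fun i hi => Finset.mem_range.2 (h.1 i hi)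
  simpa using Finset.card_le_card hD

theorem bddAbove_fitSizes (d : X → X → ℝ) (x y : ℕ → X) (n : ℕ) (δ : ℝ) :
    BddAbove {m : ℕ | ∃ D R p, IsMatch d x y n δ D R p ∧ D.card = m} := by
  refine ⟨n, ?_⟩
  rintro _ ⟨D, R, p, h, rfl⟩
  exact h.card_le

theorem IsMatch.card_le_maxFit {n : ℕ} {D R : Finset ℕ} {p : ℕ → ℕ}
    (h : IsMatch d x y n δ D R p) : D.card ≤ maxFit d x y n δ :=
  le_csSup (bddAbove_fitSizes d x y n δ) ⟨D, R, p, h, rfl⟩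

theorem exists_isMatch_card_eq_maxFit (d : X → X → ℝ) (x y : ℕ → X) (n : ℕ) (δ : ℝ) :
    ∃ D R p, IsMatch d x y n δ D R p ∧ D.card = maxFit d x y n δ :=
  Nat.sSup_mem (s := {m : ℕ | ∃ D R p, IsMatch d x y n δ D R p ∧ D.card = m})
    ⟨0, ∅, ∅, id, by simp [IsMatch], rfl⟩ (bddAbove_fitSizes d x y n δ)

theorem maxFit_le (d : X → X → ℝ) (x y : ℕ → X) (n : ℕ) (δ : ℝ) :
    maxFit d x y n δ ≤ n := by
  obtain ⟨D, R, p, h, hc⟩ := exists_isMatch_card_eq_maxFit d x y n δ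
  exact hc ▸ h.card_le

theorem maxFit_mono (d : X → X → ℝ) (x y : ℕ → X) (δ : ℝ) {m n : ℕ} (hmn : m ≤ n) :
    maxFit d x y m δ ≤ maxFit d x y n δ := by
  obtain ⟨D, R, p, h, hc⟩ := exists_isMatch_card_eq_maxFit d x y m δ
  have h' : IsMatch d x y n δ D R p :=
    ⟨fun i hi => (h.1 i hi).trans_le hmn, fun j hj => (h.2.1 j hj).trans_le hmn, h.2.2⟩
  exact hc ▸ h'.card_le_maxFit

/-- A match is determined by an order-preserving map on its domain. -/
theorem isMatch_image {n : ℕ} {D : Finset ℕ} {p : ℕ → ℕ} (hD : ∀ i ∈ D, i < n)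
    (hp : ∀ i ∈ D, p i < n) (hmono : ∀ i ∈ D, ∀ j ∈ D, i < j → p i < p j)
    (hd : ∀ i ∈ D, d (x i) (y (p i)) < δ) : IsMatch d x y n δ D (D.image p) p := by
  have hinj : Set.InjOn p ↑D := StrictMonoOn.injOn fun i hi j hj => hmono i hi j hj
  refine ⟨hD, ?_, ?_, hmono, hd⟩
  · simpa using hp
  · rw [Finset.coe_image]
    exact hinj.bijOn_image

/-- Concatenating matches: if `k` is a common period, the maximal fit size is superadditive. -/
theorem maxFit_add_le {k : ℕ} (hx : ∀ i, x (i + k) = x i) (hy : ∀ i, y (i + k) = y i) (n : ℕ) :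
    maxFit d x y k δ + maxFit d x y n δ ≤ maxFit d x y (k + n) δ := by
  obtain ⟨D, R, p, h, hc⟩ := exists_isMatch_card_eq_maxFit d x y k δ
  obtain ⟨E, S, q, h', hc'⟩ := exists_isMatch_card_eq_maxFit d x y n δ
  obtain ⟨hD, hR, hbij, hmono, hd⟩ := h
  obtain ⟨hE, hS, hbij', hmono', hd'⟩ := h'
  have hp : ∀ i ∈ D, p i < k := fun i hi => hR _ (hbij.mapsTo hi)
  have hq : ∀ i ∈ E, q i < n := fun i hi => hS _ (hbij'.mapsTo hi)
  have hdisj : Disjoint D (E.map (addRightEmbedding k)) := by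
    rw [Finset.disjoint_left]
    intro i hi hi'
    obtain ⟨j, -, rfl⟩ := Finset.mem_map.1 hi'
    have := hD _ hi
    simp at this
  let r : ℕ → ℕ := fun i => if i < k then p i else q (i - k) + k
  have hr : ∀ i ∈ D, r i = p i := fun i hi => if_pos (hD i hi)
  have hr' : ∀ i, r (i + k) = q i + k := fun i => by simp [r]
  have key : IsMatch d x y (k + n) δ (D ∪ E.map (addRightEmbedding k))
      ((D ∪ E.map (addRightEmbedding k)).image r) r := by
    have hmem : ∀ P : ℕ → Prop, (∀ i ∈ D, P i) → (∀ i ∈ E, P (i + k)) →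
        ∀ i ∈ D ∪ E.map (addRightEmbedding k), P i := by
      intro P h₁ h₂ i hi
      rcases Finset.mem_union.1 hi with hi | hi
      · exact h₁ i hi
      · obtain ⟨j, hj, rfl⟩ := Finset.mem_map.1 hi
        exact h₂ j hj
    refine isMatch_image (hmem _ ?_ ?_) (hmem _ ?_ ?_) (hmem _ ?_ ?_) (hmem _ ?_ ?_)
    · intro i hi
      have := hD i hi
      omega
    · intro i hi
      have := hE i hi
      omega
    · intro i hi
      have := hp i hi
      rw [hr i hi]
      omega
    · intro i hi
      have := hq i hi
      rw [hr']
      omega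
    · refine fun i hi => hmem _ ?_ ?_
      · intro j hj hij
        rw [hr i hi, hr j hj]
        exact hmono i hi j hj hij
      · intro j hj hij
        have := hp i hi
        rw [hr i hi, hr']
        omega
    · refine fun i hi => hmem _ ?_ ?_
      · intro j hj hij
        have := hD j hj
        omega
      · intro j hj hij
        have := hmono' i hi j hj (by omega)
        rw [hr', hr']
        omega
    · intro i hi
      rw [hr i hi]
      exact hd i hi
    · intro i hi
      rw [hr', hx, hy]
      exact hd' i hi
  calc maxFit d x y k δ + maxFit d x y n δ
      = (D ∪ E.map (addRightEmbedding k)).card := by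
        rw [Finset.card_union_of_disjoint hdisj, Finset.card_map, hc, hc']
    _ ≤ maxFit d x y (k + n) δ := key.card_le_maxFit

/-- For periodic sequences the maximal fit size grows at a definite linear rate. -/
theorem exists_tendsto_maxFit_div {N : ℕ} (hN : 0 < N) (hx : ∀ i, x (i + N) = x i)
    (hy : ∀ i, y (i + N) = y i) :
    ∃ l : ℝ, Tendsto (fun n : ℕ => (maxFit d x y n δ : ℝ) / n) atTop (nhds l) := by
  have hN' : (0 : ℝ) < N := by exact_mod_cast hN
  let c : ℕ → ℝ := fun m => maxFit d x y (m * N) δ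
  have hsub : Subadditive fun m => -c m := by
    intro m n
    have hperiod : ∀ {z : ℕ → X}, (∀ i, z (i + N) = z i) → ∀ i, z (i + m * N) = z i :=
      fun hz i => (show Function.Periodic _ N from hz).nat_mul m i
    have h := maxFit_add_le (d := d) (δ := δ) (hperiod hx) (hperiod hy) (n * N)
    rw [← add_mul] at h
    have h' : c m + c n ≤ c (m + n) := by
      simp only [c]
      exact_mod_cast h
    linarith
  have hbdd : BddBelow (range fun m : ℕ => -c m / m) := by
    refine ⟨-N, ?_⟩
    rintro _ ⟨m, rfl⟩
    rcases Nat.eq_zero_or_pos m with rfl | hm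
    · simp
    · have hm' : (0 : ℝ) < m := by exact_mod_cast hm
      have h : c m ≤ m * N := by
        simp only [c]
        exact_mod_cast maxFit_le d x y (m * N) δ
      show -(N : ℝ) ≤ -c m / m
      rw [le_div_iff₀ hm']
      linarith
  have hc : Tendsto (fun m : ℕ => c m / m) atTop (nhds (-hsub.lim)) := by
    simpa [neg_div] using (hsub.tendsto_lim hbdd).neg
  have hdiv : Tendsto (fun n : ℕ => n / N) atTop atTop :=
    Nat.tendsto_div_const_atTop hN.ne'
  have hquot : Tendsto (fun n : ℕ => ((n / N : ℕ) : ℝ) / n) atTop (nhds (N : ℝ)⁻¹) := by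
    have h := (tendsto_nat_floor_mul_div_atTop (R := ℝ) (inv_nonneg.2 hN'.le)).comp
      (tendsto_natCast_atTop_atTop (R := ℝ))
    refine h.congr fun n => ?_
    simp only [Function.comp_apply]
    rw [inv_mul_eq_div, Nat.floor_div_eq_div]
  have hquot' : Tendsto (fun n : ℕ => ((n / N + 1 : ℕ) : ℝ) / n) atTop (nhds (N : ℝ)⁻¹) := by
    have h := hquot.add (tendsto_inv_atTop_nhds_zero_nat (𝕜 := ℝ))
    rw [add_zero] at h
    refine h.congr fun n => ?_
    push_cast
    ring
  have hlow := (hc.comp hdiv).mul hquot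
  have hupp := (hc.comp ((tendsto_add_atTop_nat 1).comp hdiv)).mul hquot'
  refine ⟨_, tendsto_of_tendsto_of_tendsto_of_le_of_le' hlow hupp ?_ ?_⟩
  · filter_upwards [eventually_ge_atTop N] with n hn
    have hq : ((n / N : ℕ) : ℝ) ≠ 0 := by exact_mod_cast (Nat.div_pos hn hN).ne'
    simp only [Function.comp_apply]
    rw [div_mul_div_cancel₀ hq]
    gcongr
    exact Nat.cast_le.2 <| maxFit_mono d x y δ (Nat.div_mul_le_self n N)
  · refine Eventually.of_forall fun n => ?_
    have hq : ((n / N + 1 : ℕ) : ℝ) ≠ 0 := by positivity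
    simp only [Function.comp_apply]
    rw [div_mul_div_cancel₀ hq]
    gcongr
    exact Nat.cast_le.2 <| maxFit_mono d x y δ (Nat.lt_mul_of_div_lt (Nat.lt_succ_self _) hN).le

end Matching

/-- For periodic sequences `x, y` in a compact metric space with a common
period `N`, the limit `lim_m f̄_{mN,δ}(x,y)` exists and equals `f̄_δ(x,y)`. -/
theorem gapDist_eq_lim_of_periodic {X : Type*} [MetricSpace X] [CompactSpace X]
    (x y : ℕ → X) (N : ℕ) (hN : 0 < N)
    (hx : ∀ i, x (i + N) = x i) (hy : ∀ i, y (i + N) = y i)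
    (δ : ℝ) (hδ : 0 < δ) :
    Tendsto (fun m => gapFn dist x y (m * N) δ) atTop (nhds (gapDist dist x y δ)) := by
  obtain ⟨l, hl⟩ := exists_tendsto_maxFit_div (d := dist) (δ := δ) hN hx hy
  have hgap : Tendsto (fun n => gapFn dist x y n δ) atTop (nhds (1 - l)) :=
    hl.const_sub 1
  rw [show gapDist dist x y δ = 1 - l from hgap.limsup_eq]
  exact hgap.comp (tendsto_id.atTop_mul_const' hN)

end
end
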